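/- arXiv:2202.08764 — 6 statements merged into one kernel-verified Lean document; each statement's English description precedes it below -/
import Mathlib

section
/- For all positive integers k and all n ≥ 4k−4, g(n, k) ≥ (k−1)·⌊(n−k+1)/3⌋ + C(k−1, 2)/6 − 7/2 − (k+2)/6, where C(k−1, 2) = (k−1)(k−2)/2. -/
/-- A linear quadruple system on vertex set `Fin n`: a 4-uniform hypergraph in which
every pair of vertices lies in at most one quadruple (equivalently, two distinct
quadruples share at most one vertex). -/
structure LinearQuadSystem (n : ℕ) where
  edges : Finset (Finset (Fin n))
  card_four : ∀ e ∈ edges, e.card = 4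
  linear : ∀ e ∈ edges, ∀ f ∈ edges, e ≠ f → (e ∩ f).card ≤ 1

/-- `g n k`: the maximum, over linear quadruple systems `H` on `n` vertices and
`(k-1)`-element vertex subsets `A`, of the number of quadruples of `H` meeting `A`. -/
noncomputable def g (n k : ℕ) : ℕ :=
  sSup {m | ∃ H : LinearQuadSystem n, ∃ A : Finset (Fin n), A.card = k - 1 ∧
    (H.edges.filter (fun e => (e ∩ A).Nonempty)).card = m}

/-- A linear family of `4`-element sets. -/
def IsPacking {α : Type} [DecidableEq α] (B : Finset (Finset α)) : Prop :=
  (∀ e ∈ B, e.card = 4) ∧ ∀ e ∈ B, ∀ f ∈ B, e ≠ f → (e ∩ f).card ≤ 1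

/-- There are at least `N` blocks in some packing of quadruples on `v` points whose blocks meet
a fixed set (the hole) of `w` points in at most one point each. -/
def HasPacking (v w N : ℕ) : Prop :=
  ∃ (α : Type) (_ : DecidableEq α) (V H : Finset α) (B : Finset (Finset α)),
    H ⊆ V ∧ V.card = v ∧ H.card = w ∧ IsPacking B ∧
    (∀ e ∈ B, e ⊆ V ∧ (e ∩ H).card ≤ 1) ∧ N ≤ B.card

theorem injOn_image_finset {α β : Type} [DecidableEq β] {V : Finset α} {φ : α → β}
    (hφ : Set.InjOn φ V) {B : Finset (Finset α)} (hV : ∀ e ∈ B, e ⊆ V) :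
    Set.InjOn (Finset.image φ) (B : Set (Finset α)) := by
  intro e he f hf h
  have key : ∀ e ∈ B, ∀ f ∈ B, e.image φ = f.image φ → e ⊆ f := by
    intro e he f hf h x hx
    have : φ x ∈ f.image φ := h ▸ Finset.mem_image_of_mem φ hx
    obtain ⟨y, hy, hxy⟩ := Finset.mem_image.1 this
    rwa [← hφ (hV f hf hy) (hV e he hx) hxy]
  exact (key e he f hf h).antisymm (key f hf e he h.symm)

section Packing

variable {α β : Type} [DecidableEq α] [DecidableEq β]

theorem IsPacking.subset {B C : Finset (Finset α)} (hC : IsPacking C) (h : B ⊆ C) :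
    IsPacking B :=
  ⟨fun e he => hC.1 e (h he), fun e he f hf => hC.2 e (h he) f (h hf)⟩

theorem card_image_inter_image {V e f : Finset α} {φ : α → β} (hφ : Set.InjOn φ V)
    (he : e ⊆ V) (hf : f ⊆ V) : (e.image φ ∩ f.image φ).card = (e ∩ f).card := by
  rw [← Finset.image_inter_of_injOn]
  · exact Finset.card_image_of_injOn (hφ.mono (by
      intro x hx
      exact he (Finset.mem_inter.1 hx).1))
  · refine hφ.mono ?_
    rintro x (hx | hx)
    · exact he hx
    · exact hf hx

theorem IsPacking.image {V : Finset α} {φ : α → β} (hφ : Set.InjOn φ V)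
    {B : Finset (Finset α)} (hB : IsPacking B) (hV : ∀ e ∈ B, e ⊆ V) :
    IsPacking (B.image (Finset.image φ)) := by
  constructor
  · intro e he
    obtain ⟨e, he', rfl⟩ := Finset.mem_image.1 he
    rw [Finset.card_image_of_injOn (hφ.mono (hV e he')), hB.1 e he']
  · intro e he f hf hef
    obtain ⟨e, he', rfl⟩ := Finset.mem_image.1 he
    obtain ⟨f, hf', rfl⟩ := Finset.mem_image.1 hf
    rw [card_image_inter_image hφ (hV e he') (hV f hf')]
    exact hB.2 e he' f hf' (fun h => hef (h ▸ rfl))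

theorem IsPacking.union {B C : Finset (Finset α)} (hB : IsPacking B) (hC : IsPacking C)
    (h : ∀ e ∈ B, ∀ f ∈ C, (e ∩ f).card ≤ 1) :
    IsPacking (B ∪ C) ∧ (B ∪ C).card = B.card + C.card := by
  refine ⟨⟨?_, ?_⟩, ?_⟩
  · intro e he
    rcases Finset.mem_union.1 he with he | he
    exacts [hB.1 e he, hC.1 e he]
  · intro e he f hf hef
    rcases Finset.mem_union.1 he with he | he <;> rcases Finset.mem_union.1 hf with hf | hf
    · exact hB.2 e he f hf hef
    · exact h e he f hf
    · rw [Finset.inter_comm]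
      exact h f hf e he
    · exact hC.2 e he f hf hef
  · refine Finset.card_union_of_disjoint (Finset.disjoint_left.2 fun e he he' => ?_)
    have := h e he e he'
    rw [Finset.inter_self, hB.1 e he] at this
    omega

theorem IsPacking.biUnion {ι : Type} [DecidableEq ι] (I : Finset ι)
    {B : ι → Finset (Finset α)} (hB : ∀ i ∈ I, IsPacking (B i))
    (h : ∀ i ∈ I, ∀ j ∈ I, i ≠ j → ∀ e ∈ B i, ∀ f ∈ B j, (e ∩ f).card ≤ 1) :
    IsPacking (I.biUnion B) ∧ (I.biUnion B).card = ∑ i ∈ I, (B i).card := by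
  induction I using Finset.induction_on with
  | empty => simp [IsPacking]
  | insert a s has ih =>
    obtain ⟨ih₁, ih₂⟩ := ih (fun i hi => hB i (Finset.mem_insert_of_mem hi))
      (fun i hi j hj => h i (Finset.mem_insert_of_mem hi) j (Finset.mem_insert_of_mem hj))
    rw [Finset.biUnion_insert, Finset.sum_insert has, ← ih₂]
    refine (hB a (Finset.mem_insert_self a s)).union ih₁ fun e he f hf => ?_
    obtain ⟨j, hj, hf⟩ := Finset.mem_biUnion.1 hf
    exact h a (Finset.mem_insert_self a s) j (Finset.mem_insert_of_mem hj)
      (fun haj => has (haj ▸ hj)) e he f hf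

theorem isPacking_image_of_family {ι : Type} [DecidableEq ι] (I : Finset ι) (b : ι → Finset α)
    (hb : ∀ i ∈ I, (b i).card = 4)
    (h : ∀ i ∈ I, ∀ j ∈ I, i ≠ j → (b i ∩ b j).card ≤ 1) :
    IsPacking (I.image b) ∧ (I.image b).card = I.card := by
  have := IsPacking.biUnion I (B := fun i => {b i})
    (fun i hi => ⟨by simpa using hb i hi, by simp⟩)
    (fun i hi j hj hij e he f hf => by
      rw [Finset.mem_singleton.1 he, Finset.mem_singleton.1 hf]
      exact h i hi j hj hij)
  rw [Finset.biUnion_singleton] at this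
  simpa using this

end Packing

theorem HasPacking.transfer {v w N : ℕ} (h : HasPacking v w N) {β : Type} [DecidableEq β]
    [Nonempty β] {V H : Finset β} (hHV : H ⊆ V) (hV : V.card = v) (hH : H.card = w) :
    ∃ B : Finset (Finset β), IsPacking B ∧ (∀ e ∈ B, e ⊆ V ∧ (e ∩ H).card ≤ 1) ∧ N ≤ B.card := by
  obtain ⟨α, _, V₀, H₀, B, hHV₀, hV₀, hH₀, hB, hBV, hN⟩ := h
  obtain ⟨φ₁, hφ₁⟩ := (Finset.finite_toSet H₀).exists_bijOn_of_encard_eq (t := (H : Set β))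
    (by simp [Set.encard_coe_eq_coe_finsetCard, hH, hH₀])
  obtain ⟨φ₂, hφ₂⟩ := (Finset.finite_toSet (V₀ \ H₀)).exists_bijOn_of_encard_eq
    (t := ((V \ H : Finset β) : Set β))
    (by simp only [Set.encard_coe_eq_coe_finsetCard, Finset.card_sdiff_of_subset hHV,
      Finset.card_sdiff_of_subset hHV₀, hV, hH, hV₀, hH₀])
  let φ : α → β := fun x => if x ∈ H₀ then φ₁ x else φ₂ x
  have hφH : ∀ x ∈ H₀, φ x ∈ H := by
    intro x hx
    simp only [φ, if_pos hx]
    exact hφ₁.mapsTo hx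
  have hφV : ∀ x ∈ V₀, x ∉ H₀ → φ x ∈ V \ H := by
    intro x hx hx'
    simp only [φ, if_neg hx']
    exact hφ₂.mapsTo (by simp [hx, hx'])
  have hmap : ∀ x ∈ V₀, φ x ∈ V := by
    intro x hx
    by_cases hx' : x ∈ H₀
    · exact hHV (hφH x hx')
    · exact (Finset.mem_sdiff.1 (hφV x hx hx')).1
  have hinj : Set.InjOn φ V₀ := by
    intro x hx y hy hxy
    by_cases hx' : x ∈ H₀ <;> by_cases hy' : y ∈ H₀
    · simp only [φ, if_pos hx', if_pos hy'] at hxy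
      exact hφ₁.injOn hx' hy' hxy
    · exact absurd (hxy ▸ hφH x hx') (Finset.mem_sdiff.1 (hφV y hy hy')).2
    · exact absurd (hxy ▸ hφH y hy') (Finset.mem_sdiff.1 (hφV x hx hx')).2
    · simp only [φ, if_neg hx', if_neg hy'] at hxy
      exact hφ₂.injOn (by simpa [hx'] using hx) (by simpa [hy'] using hy) hxy
  have hH₀H : H₀.image φ = H := by
    refine Finset.eq_of_subset_of_card_le ?_ ?_
    · intro y hy
      obtain ⟨x, hx, rfl⟩ := Finset.mem_image.1 hy
      exact hφH x hx
    · rw [Finset.card_image_of_injOn (hinj.mono hHV₀), hH, hH₀]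
  refine ⟨B.image (Finset.image φ), hB.image hinj fun e he => (hBV e he).1, ?_, ?_⟩
  · intro e he
    obtain ⟨e, he', rfl⟩ := Finset.mem_image.1 he
    obtain ⟨heV, heH⟩ := hBV e he'
    refine ⟨?_, ?_⟩
    · intro y hy
      obtain ⟨x, hx, rfl⟩ := Finset.mem_image.1 hy
      exact hmap x (heV hx)
    · rwa [← hH₀H, card_image_inter_image hinj heV hHV₀]
  · rwa [Finset.card_image_of_injOn (injOn_image_finset hinj fun e he => (hBV e he).1)]

theorem HasPacking.forget_hole {v w N : ℕ} (h : HasPacking v w N) : HasPacking v 0 N := by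
  obtain ⟨α, i, V, H, B, -, h₂, -, h₄, h₅, h₆⟩ := h
  exact ⟨α, i, V, ∅, B, by simp, h₂, rfl, h₄, fun e he => ⟨(h₅ e he).1, by simp⟩, h₆⟩

theorem HasPacking.point_hole {v N : ℕ} (h : HasPacking v 0 N) (hv : 1 ≤ v) :
    HasPacking v 1 N := by
  obtain ⟨α, i, V, H, B, -, h₂, -, h₄, h₅, h₆⟩ := h
  obtain ⟨x, hx⟩ := Finset.card_pos.1 (h₂ ▸ hv)
  exact ⟨α, i, V, {x}, B, by simpa using hx, h₂, rfl, h₄, fun e he => ⟨(h₅ e he).1,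
    (Finset.card_le_card Finset.inter_subset_right).trans (by simp)⟩, h₆⟩

theorem HasPacking.block_hole {v N : ℕ} (h : HasPacking v 0 (N + 1)) : HasPacking v 4 N := by
  obtain ⟨α, i, V, H, B, -, h₂, -, h₄, h₅, h₆⟩ := h
  obtain ⟨b, hb⟩ := Finset.card_pos.1 (Nat.zero_lt_of_lt h₆)
  refine ⟨α, i, V, b, B.erase b, (h₅ b hb).1, h₂, h₄.1 b hb, h₄.subset (Finset.erase_subset b B),
    fun e he => ⟨(h₅ e (Finset.mem_of_mem_erase he)).1,
      h₄.2 e (Finset.mem_of_mem_erase he) b hb (Finset.ne_of_mem_erase he)⟩, ?_⟩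
  rw [Finset.card_erase_of_mem hb]
  omega

theorem HasPacking.isolated_hole {v w N : ℕ} (h : HasPacking v w N) :
    HasPacking (v + 1) (w + 1) N := by
  obtain ⟨α, i, V, H, B, h₁, h₂, h₃, h₄, h₅, h₆⟩ := h
  have hs : Set.InjOn (some : α → Option α) V := (Option.some_injective α).injOn
  refine ⟨Option α, inferInstance, V.insertNone, H.insertNone, B.image (Finset.image some),
    Finset.insertNone.monotone h₁, by simp [h₂], by simp [h₃],
    h₄.image hs fun e he => (h₅ e he).1, ?_, ?_⟩
  · intro e he
    obtain ⟨e, he', rfl⟩ := Finset.mem_image.1 he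
    refine ⟨?_, ?_⟩
    · intro y hy
      obtain ⟨x, hx, rfl⟩ := Finset.mem_image.1 hy
      exact Finset.some_mem_insertNone.2 ((h₅ e he').1 hx)
    · rw [show e.image some ∩ H.insertNone = (e ∩ H).image some by
        ext x
        cases x <;> simp]
      exact Finset.card_image_le.trans (h₅ e he').2
  · rwa [Finset.card_image_of_injOn (injOn_image_finset hs fun e he => (h₅ e he).1)]

theorem HasPacking.delete_point {r N : ℕ} (h : HasPacking (3 * r + 1) 0 N) :
    HasPacking (3 * r) 0 (N - r) := by
  obtain ⟨α, i, V, H, B, -, h₂, -, h₄, h₅, h₆⟩ := h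
  obtain ⟨x, hx⟩ := Finset.card_pos.1 (by omega : 0 < V.card)
  refine ⟨α, i, V.erase x, ∅, B.filter (x ∉ ·), by simp,
    by rw [Finset.card_erase_of_mem hx, h₂]; rfl, rfl, h₄.subset (Finset.filter_subset _ _), ?_, ?_⟩
  · intro e he
    obtain ⟨he, hxe⟩ := Finset.mem_filter.1 he
    exact ⟨fun y hy => Finset.mem_erase.2 ⟨fun hyx => hxe (hyx ▸ hy), (h₅ e he).1 hy⟩, by simp⟩
  · have hd : (B.filter (x ∈ ·)).card ≤ r := by
      have hcard : ((B.filter (x ∈ ·)).biUnion fun e => e.erase x).card =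
          ∑ e ∈ B.filter (x ∈ ·), (e.erase x).card := by
        refine Finset.card_biUnion fun e he f hf hef => ?_
        rw [Finset.mem_coe, Finset.mem_filter] at he hf
        change Disjoint _ _
        refine Finset.disjoint_left.2 fun y hy hy' => ?_
        rw [Finset.mem_erase] at hy hy'
        exact hy.1 (Finset.card_le_one.1 (h₄.2 e he.1 f hf.1 hef) y
          (Finset.mem_inter.2 ⟨hy.2, hy'.2⟩) x (Finset.mem_inter.2 ⟨he.2, hf.2⟩))
      rw [Finset.sum_congr rfl (g := fun _ => 3) (fun e he => by
        rw [Finset.mem_filter] at he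
        rw [Finset.card_erase_of_mem he.2, h₄.1 e he.1])] at hcard
      have hle : ((B.filter (x ∈ ·)).biUnion fun e => e.erase x).card ≤ (V.erase x).card := by
        refine Finset.card_le_card fun y hy => ?_
        obtain ⟨e, he, hy⟩ := Finset.mem_biUnion.1 hy
        exact Finset.erase_subset_erase x (h₅ e (Finset.mem_filter.1 he).1).1 hy
      rw [Finset.card_erase_of_mem hx, h₂, hcard, Finset.sum_const, smul_eq_mul] at hle
      omega
    have := Finset.card_filter_add_card_filter_not (s := B) (x ∈ ·)
    omega


/-- Shift `x` by `j` within the consecutive cyclic blocks of lengths given by the list. -/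
def rotate : List ℕ → ℕ → ℕ → ℕ
  | [], _, x => x
  | l :: ls, j, x => if x < l then (x + j) % l else l + rotate ls j (x - l)

/-- The blocks obtained by developing base blocks: `(b, m)` stands for the first `m` shifts
of `b`. -/
def develop (cs : List ℕ) (bs : List (List ℕ × ℕ)) : List (List ℕ) :=
  bs.flatMap fun p => (List.range p.2).map fun j => p.1.map (rotate cs j)

/-- The codes of the pairs contained in a block. -/
def pairCodes (v : ℕ) : List ℕ → List ℕ
  | [] => []
  | x :: l => l.map (fun y => min x y * v + max x y) ++ pairCodes v l

/-- Whether the list has no repetition and avoids the bits set in the mask `m`. -/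
def distinctAux : List ℕ → ℕ → Bool
  | [], _ => true
  | c :: l, m => !m.testBit c && distinctAux l (m ||| 1 <<< c)

/-- Whether a list of quadruples of numbers below `v` is linear. -/
def checkBlocks (v : ℕ) (B : List (List ℕ)) : Bool :=
  B.all (fun b => b.length == 4 && b.all (fun x => decide (x < v)) && decide b.Nodup) &&
    distinctAux (B.flatMap (pairCodes v)) 0

theorem nodup_of_distinctAux : ∀ (l : List ℕ) (m : ℕ), distinctAux l m = true →
    l.Nodup ∧ ∀ c ∈ l, m.testBit c = false
  | [], _, _ => by simp
  | c :: l, m, h => by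
    simp only [distinctAux, Bool.and_eq_true, Bool.not_eq_true'] at h
    obtain ⟨h₁, h₂⟩ := nodup_of_distinctAux l _ h.2
    simp only [Nat.testBit_or, Bool.or_eq_false_iff] at h₂
    refine ⟨List.nodup_cons.2 ⟨fun hc => ?_, h₁⟩, ?_⟩
    · have := (h₂ c hc).2
      simp [Nat.one_shiftLeft, Nat.testBit_two_pow_self] at this
    · intro d hd
      rcases List.mem_cons.1 hd with rfl | hd
      · exact h.1
      · exact (h₂ d hd).1

theorem mem_pairCodes (v : ℕ) {x y : ℕ} (hxy : x ≠ y) : ∀ {l : List ℕ}, x ∈ l → y ∈ l →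
    min x y * v + max x y ∈ pairCodes v l
  | a :: l, hx, hy => by
    simp only [pairCodes, List.mem_append, List.mem_map]
    rcases List.mem_cons.1 hx with rfl | hx' <;> rcases List.mem_cons.1 hy with rfl | hy'
    · exact absurd rfl hxy
    · exact Or.inl ⟨y, hy', rfl⟩
    · exact Or.inl ⟨x, hx', by rw [min_comm, max_comm]⟩
    · exact Or.inr (mem_pairCodes v hxy hx' hy')

theorem hasPacking_of_checkBlocks {v : ℕ} {B : List (List ℕ)} (h : checkBlocks v B = true) :
    HasPacking v 0 B.length := by
  simp only [checkBlocks, Bool.and_eq_true, List.all_eq_true, beq_iff_eq, decide_eq_true_eq] at h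
  obtain ⟨hB, hd⟩ := h
  have hpair := (List.nodup_flatMap.1 (nodup_of_distinctAux _ _ hd).1).2
  have hinter : ∀ i j : Fin B.length, i < j →
      ((B.get i).toFinset ∩ (B.get j).toFinset).card ≤ 1 := by
    intro i j hij
    refine Finset.card_le_one.2 fun x hx y hy => ?_
    simp only [Finset.mem_inter, List.mem_toFinset] at hx hy
    by_contra hxy
    exact List.pairwise_iff_get.1 hpair i j hij (mem_pairCodes v hxy hx.1 hy.1)
      (mem_pairCodes v hxy hx.2 hy.2)
  obtain ⟨h₁, h₂⟩ := isPacking_image_of_family (Finset.univ : Finset (Fin B.length))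
    (fun i => (B.get i).toFinset)
    (fun i _ => by
      obtain ⟨⟨h₁, -⟩, h₂⟩ := hB _ (List.get_mem B i)
      rw [List.toFinset_card_of_nodup h₂, h₁])
    (fun i _ j _ hij => by
      rcases lt_or_gt_of_ne hij with hij | hij
      · exact hinter i j hij
      · rw [Finset.inter_comm]
        exact hinter j i hij)
  refine ⟨ℕ, inferInstance, Finset.range v, ∅, _, by simp, by simp, rfl, h₁, ?_, ?_⟩
  · intro e he
    obtain ⟨i, -, rfl⟩ := Finset.mem_image.1 he
    refine ⟨fun x hx => ?_, by simp⟩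
    exact Finset.mem_range.2 ((hB _ (List.get_mem B i)).1.2 x (List.mem_toFinset.1 hx))
  · exact (h₂.trans (by simp)).ge

theorem hasPacking_develop (v : ℕ) (cs : List ℕ) (bs : List (List ℕ × ℕ))
    (h : checkBlocks v (develop cs bs) = true) : HasPacking v 0 (bs.map Prod.snd).sum := by
  have := hasPacking_of_checkBlocks h
  rwa [show (develop cs bs).length = (bs.map Prod.snd).sum by
    simp [develop, List.length_flatMap]] at this

theorem hasPacking_7 : HasPacking 7 0 2 :=
  hasPacking_develop 7 [1, 1, 1, 1, 1, 1, 1]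
    [([0, 1, 5, 6], 1), ([1, 2, 3, 4], 1)]
    (by decide +kernel)

theorem hasPacking_10 : HasPacking 10 0 4 :=
  hasPacking_develop 10 [1, 1, 1, 1, 1, 1, 1, 1, 1, 1]
    [([0, 2, 4, 5], 1), ([1, 3, 4, 7], 1), ([1, 5, 8, 9], 1), ([2, 6, 7, 8], 1)]
    (by decide +kernel)

theorem hasPacking_13 : HasPacking 13 0 13 :=
  hasPacking_develop 13 [13]
    [([0, 1, 5, 11], 13)]
    (by decide +kernel)

theorem hasPacking_16 : HasPacking 16 0 20 :=
  hasPacking_develop 16 [1, 5, 5, 5]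
    [([0, 1, 7, 11], 5), ([1, 2, 6, 9], 5), ([1, 3, 14, 15], 5), ([6, 7, 12, 14], 5)]
    (by decide +kernel)

theorem hasPacking_19 : HasPacking 19 0 25 :=
  hasPacking_develop 19 [1, 3, 3, 3, 3, 3, 3]
    [([0, 1, 5, 8], 3), ([0, 10, 11, 12], 1), ([1, 4, 9, 10], 3), ([1, 6, 11, 16], 3),
    ([1, 7, 14, 17], 3), ([1, 12, 13, 15], 3), ([4, 5, 15, 16], 3), ([4, 8, 11, 13], 3),
    ([7, 12, 16, 18], 3)]
    (by decide +kernel)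

theorem hasPacking_20 : HasPacking 20 0 30 :=
  hasPacking_develop 20 [5, 5, 5, 5]
    [([0, 1, 11, 13], 5), ([0, 2, 6, 7], 5), ([0, 8, 15, 19], 5), ([0, 14, 16, 18], 5),
    ([5, 7, 12, 15], 5), ([5, 13, 14, 19], 5)]
    (by decide +kernel)

theorem hasPacking_22 : HasPacking 22 0 35 :=
  hasPacking_develop 22 [7, 7, 7, 1]
    [([0, 7, 13, 19], 7), ([0, 8, 12, 15], 7), ([0, 9, 11, 20], 7), ([0, 10, 18, 21], 7),
    ([0, 14, 16, 17], 7)]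
    (by decide +kernel)

theorem hasPacking_25 : HasPacking 25 0 50 :=
  hasPacking_develop 25 [5, 5, 5, 5, 5]
    [([0, 1, 13, 23], 5), ([0, 2, 5, 18], 5), ([0, 6, 10, 14], 5), ([0, 7, 9, 21], 5),
    ([0, 11, 15, 17], 5), ([0, 19, 20, 24], 5), ([5, 6, 12, 15], 5), ([5, 10, 21, 23], 5),
    ([5, 16, 17, 20], 5), ([10, 12, 17, 24], 5)]
    (by decide +kernel)

theorem hasPacking_28 : HasPacking 28 0 63 :=
  hasPacking_develop 28 [7, 7, 7, 7]
    [([0, 1, 14, 24], 7), ([0, 2, 10, 21], 7), ([0, 3, 7, 12], 7), ([0, 13, 17, 18], 7),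
    ([0, 15, 22, 27], 7), ([0, 16, 19, 25], 7), ([7, 8, 15, 17], 7), ([7, 10, 22, 23], 7),
    ([7, 20, 21, 24], 7)]
    (by decide +kernel)

theorem hasPacking_31 : HasPacking 31 0 76 :=
  hasPacking_develop 31 [1, 6, 6, 6, 6, 6]
    [([0, 7, 18, 27], 6), ([0, 19, 21, 23], 2), ([1, 7, 15, 17], 6), ([1, 8, 12, 29], 6),
    ([1, 9, 10, 21], 6), ([1, 11, 14, 30], 6), ([1, 13, 19, 24], 6), ([1, 16, 23, 28], 6),
    ([1, 18, 22, 25], 6), ([1, 20, 26, 27], 6), ([7, 10, 20, 23], 3), ([7, 13, 14, 22], 6),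
    ([7, 21, 25, 29], 6), ([13, 16, 27, 30], 3), ([0, 1, 2, 3], 1), ([0, 4, 5, 6], 1)]
    (by decide +kernel)

theorem hasPacking_34 : HasPacking 34 0 90 :=
  hasPacking_develop 34 [1, 3, 3, 9, 9, 9]
    [([0, 7, 21, 28], 9), ([1, 7, 23, 26], 9), ([1, 8, 21, 30], 9), ([1, 9, 19, 25], 9),
    ([4, 7, 18, 22], 9), ([4, 8, 15, 32], 9), ([4, 17, 30, 31], 9), ([7, 8, 13, 16], 9),
    ([7, 25, 27, 30], 9), ([16, 17, 19, 27], 9)]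
    (by decide +kernel)

theorem hasPacking_37 : HasPacking 37 0 111 :=
  hasPacking_develop 37 [37]
    [([0, 1, 14, 21], 37), ([0, 2, 5, 11], 37), ([0, 4, 12, 22], 37)]
    (by decide +kernel)

theorem hasPacking_40 : HasPacking 40 0 130 :=
  hasPacking_develop 40 [40]
    [([0, 1, 6, 32], 40), ([0, 2, 15, 18], 40), ([0, 4, 21, 33], 40), ([0, 10, 20, 30], 10)]
    (by decide +kernel)

theorem hasPacking_43 : HasPacking 43 0 149 :=
  hasPacking_develop 43 [1, 3, 3, 9, 9, 9, 9]
    [([0, 7, 28, 37], 9), ([0, 16, 19, 22], 3), ([1, 7, 27, 31], 9), ([1, 8, 26, 41], 9),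
    ([1, 9, 19, 24], 9), ([1, 17, 34, 36], 9), ([4, 7, 34, 38], 9), ([4, 8, 17, 42], 9),
    ([4, 9, 21, 26], 9), ([4, 16, 27, 28], 9), ([7, 8, 13, 24], 9), ([7, 9, 32, 35], 9),
    ([7, 20, 21, 29], 9), ([7, 26, 36, 39], 9), ([16, 18, 39, 40], 9), ([16, 26, 32, 34], 9),
    ([16, 29, 31, 36], 9), ([0, 1, 2, 3], 1), ([0, 4, 5, 6], 1)]
    (by decide +kernel)

theorem hasPacking_46 : HasPacking 46 0 169 :=
  hasPacking_develop 46 [1, 1, 1, 1, 1, 1, 1, 13, 13, 13]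
    [([0, 7, 32, 33], 13), ([1, 7, 20, 45], 13), ([2, 7, 25, 40], 13), ([3, 7, 26, 37], 13),
    ([4, 7, 27, 43], 13), ([5, 7, 22, 41], 13), ([6, 7, 21, 39], 13), ([7, 8, 17, 35], 13),
    ([7, 9, 14, 31], 13), ([7, 23, 28, 30], 13), ([7, 36, 42, 44], 13), ([20, 21, 30, 43], 13),
    ([20, 37, 40, 41], 13)]
    (by decide +kernel)

theorem hasPacking_79 : HasPacking 79 0 512 :=
  hasPacking_develop 79 [1, 6, 36, 36]
    [([0, 7, 19, 31], 12), ([0, 43, 55, 67], 12), ([1, 7, 53, 55], 36), ([1, 8, 52, 68], 36),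
    ([1, 9, 23, 30], 36), ([1, 10, 63, 72], 36), ([7, 8, 39, 43], 36), ([7, 9, 48, 54], 36),
    ([7, 10, 16, 35], 36), ([7, 17, 45, 59], 36), ([7, 20, 50, 75], 36), ([7, 23, 57, 72], 36),
    ([7, 25, 58, 76], 18), ([7, 44, 63, 70], 36), ([7, 61, 66, 74], 36), ([7, 64, 65, 68], 36),
    ([0, 1, 2, 3], 1), ([0, 4, 5, 6], 1)]
    (by decide +kernel)

theorem hasPacking_82 : HasPacking 82 0 550 :=
  hasPacking_develop 82 [1, 1, 1, 1, 1, 1, 1, 25, 25, 25]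
    [([0, 7, 47, 81], 25), ([1, 7, 35, 77], 25), ([2, 7, 38, 61], 25), ([3, 7, 43, 80], 25),
    ([4, 7, 55, 66], 25), ([5, 7, 44, 74], 25), ([6, 7, 46, 70], 25), ([7, 8, 14, 34], 25),
    ([7, 9, 18, 59], 25), ([7, 10, 15, 45], 25), ([7, 11, 64, 76], 25), ([7, 17, 51, 79], 25),
    ([7, 19, 48, 62], 25), ([7, 32, 54, 67], 25), ([7, 39, 56, 58], 25), ([7, 40, 49, 50], 25),
    ([7, 53, 71, 78], 25), ([7, 63, 65, 68], 25), ([32, 34, 39, 53], 25), ([32, 44, 73, 77], 25),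
    ([32, 58, 64, 72], 25), ([32, 63, 78, 79], 25)]
    (by decide +kernel)

theorem hasPacking_85 : HasPacking 85 0 595 :=
  hasPacking_develop 85 [85]
    [([0, 1, 16, 81], 85), ([0, 2, 52, 75], 85), ([0, 3, 17, 59], 85), ([0, 6, 31, 38], 85),
    ([0, 8, 44, 66], 85), ([0, 9, 37, 55], 85), ([0, 11, 51, 72], 85)]
    (by decide +kernel)

/-- The lines of the affine plane of order four that miss the origin, as translates of a relative
difference set. -/
def missingLine (j : Fin 15) : Finset (Fin 15) := {j, j + 1, j + 3, j + 7}

/-- The coordinates of a point of the punctured plane: its group and its place in the group. -/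
def groupCoord (x : Fin 15) : Fin 5 × Fin 3 := (Fin.ofNat 5 x.val, Fin.ofNat 3 (x.val / 5))

/-- The lines of the affine plane of order four that miss the origin, as a group divisible design
with five groups of size three. -/
def fiveGroupDesign : Finset (Finset (Fin 5 × Fin 3)) :=
  (Finset.univ.image missingLine).image (Finset.image groupCoord)

/-- The blocks of a transversal design with four groups of size three. -/
def fourGroupBlock (p : Fin 3 × Fin 3) : Finset (Fin 5 × Fin 3) :=
  {(0, p.1), (1, p.2), (2, p.1 + p.2), (3, p.1 + 2 * p.2)}

/-- A transversal design with four groups of size three. -/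
def fourGroupDesign : Finset (Finset (Fin 5 × Fin 3)) :=
  Finset.univ.image fourGroupBlock

theorem fiveGroupDesign_spec : fiveGroupDesign.card = 15 ∧ IsPacking fiveGroupDesign ∧
    ∀ e ∈ fiveGroupDesign, ∀ p ∈ e, ∀ q ∈ e, p.1 = q.1 → p = q := by
  have hinj : Function.Injective groupCoord := by
    unfold Function.Injective
    decide +kernel
  obtain ⟨h₁, h₂⟩ := isPacking_image_of_family Finset.univ missingLine
    (by decide +kernel) (by decide +kernel)
  have htrans : ∀ j, ∀ x ∈ missingLine j, ∀ y ∈ missingLine j,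
      (groupCoord x).1 = (groupCoord y).1 → x = y := by decide +kernel
  refine ⟨?_, h₁.image (V := Finset.univ) hinj.injOn fun e _ => Finset.subset_univ e, ?_⟩
  · rw [fiveGroupDesign, Finset.card_image_of_injective _ (Finset.image_injective hinj), h₂]
    rfl
  · intro e he p hp q hq hpq
    simp only [fiveGroupDesign, Finset.mem_image, Finset.mem_univ, true_and] at he
    obtain ⟨_, ⟨j, rfl⟩, rfl⟩ := he
    obtain ⟨x, hx, rfl⟩ := Finset.mem_image.1 hp
    obtain ⟨y, hy, rfl⟩ := Finset.mem_image.1 hq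
    rw [htrans j x hx y hy hpq]

theorem fourGroupDesign_spec : fourGroupDesign.card = 9 ∧ IsPacking fourGroupDesign ∧
    (∀ e ∈ fourGroupDesign, ∀ p ∈ e, ∀ q ∈ e, p.1 = q.1 → p = q) ∧
    ∀ e ∈ fourGroupDesign, ∀ p ∈ e, p.1 ≠ 4 := by
  obtain ⟨h₁, h₂⟩ := isPacking_image_of_family Finset.univ fourGroupBlock
    (by decide +kernel) (by decide +kernel)
  refine ⟨h₂, h₁, ?_, ?_⟩ <;> simp only [fourGroupDesign, Finset.forall_mem_image] <;>
    decide +kernel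

/-- The blocks on a transversal line, as a function of whether the line uses the last group. -/
def lineDesign (b : Prop) [Decidable b] : Finset (Finset (Fin 5 × Fin 3)) :=
  if b then fiveGroupDesign else fourGroupDesign

theorem lineDesign_spec (b : Prop) [Decidable b] :
    (lineDesign b).card = (if b then 15 else 9) ∧ IsPacking (lineDesign b) ∧
    (∀ e ∈ lineDesign b, ∀ p ∈ e, ∀ q ∈ e, p.1 = q.1 → p = q) ∧
    (¬ b → ∀ e ∈ lineDesign b, ∀ p ∈ e, p.1 ≠ 4) := by
  obtain ⟨h₁, h₂, h₃⟩ := fiveGroupDesign_spec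
  obtain ⟨k₁, k₂, k₃, k₄⟩ := fourGroupDesign_spec
  unfold lineDesign
  split_ifs with hb
  · exact ⟨h₁, h₂, h₃, fun h => absurd hb h⟩
  · exact ⟨k₁, k₂, k₃, fun _ => k₄⟩

/-- Truncating the last group of a transversal design with five groups of size `t` to size `s`,
giving every point weight three and filling in the groups, together with `w` extra points. -/
theorem HasPacking.fill_transversal {R : Type} [Fintype R] [DecidableEq R] [Nonempty R]
    (L : R → R → Fin 5 → R)
    (hL₄ : ∀ x y, L x y 4 = y)
    (hL : ∀ x y x' y' i j, i ≠ j → L x y i = L x' y' i → L x y j = L x' y' j → x = x' ∧ y = y')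
    {s w N₁ N₂ : ℕ} (hs : s ≤ Fintype.card R) (h₁ : HasPacking (3 * Fintype.card R + w) w N₁)
    (h₂ : HasPacking (3 * s + w) 0 N₂) :
    HasPacking (3 * (4 * Fintype.card R + s) + w) 0
      (Fintype.card R * (9 * Fintype.card R + 6 * s) + 4 * N₁ + N₂) := by
  obtain ⟨S, -, hS⟩ := Finset.exists_subset_card_eq (s := (Finset.univ : Finset R)) hs
  let T : Fin 5 → Finset R := fun i => if i = 4 then S else Finset.univ
  let W : Finset (Fin w ⊕ (Fin 5 × R × Fin 3)) := Finset.univ.disjSum ∅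
  let G : Fin 5 → Finset (Fin w ⊕ (Fin 5 × R × Fin 3)) := fun i =>
    Finset.univ.disjSum ({i} ×ˢ T i ×ˢ Finset.univ)
  let V : Finset (Fin w ⊕ (Fin 5 × R × Fin 3)) :=
    Finset.univ.disjSum (Finset.univ.biUnion fun i => {i} ×ˢ T i ×ˢ Finset.univ)
  have hW : W.card = w := by simp [W]
  have hGc : ∀ i, (G i).card = 3 * (T i).card + w := by
    intro i
    simp only [G, Finset.card_disjSum, Finset.card_product, Finset.card_univ, Fintype.card_fin,
      Finset.card_singleton]
    ring
  have hWG : ∀ i, W ⊆ G i := by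
    rintro i (x | x) hx
    · simp [G]
    · simp [W] at hx
  have hGV : ∀ i, G i ⊆ V := by
    rintro i (x | x) hx
    · simp [V]
    · simp only [G, V, Finset.inr_mem_disjSum, Finset.mem_biUnion] at hx ⊢
      exact ⟨i, Finset.mem_univ i, hx⟩
  have hVc : V.card = 3 * (4 * Fintype.card R + s) + w := by
    simp only [V, Finset.card_disjSum, Finset.card_univ, Fintype.card_fin]
    rw [Finset.card_biUnion (fun i _ j _ hij => by
      rw [Function.onFun, Finset.disjoint_left]
      rintro ⟨k, _⟩ hi hj
      simp only [Finset.mem_product, Finset.mem_singleton] at hi hj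
      exact hij (hi.1.symm.trans hj.1))]
    simp only [Finset.card_product, Finset.card_singleton, Finset.card_univ, Fintype.card_fin,
      Fin.sum_univ_five, T]
    simp [hS]
    ring
  let φ : R → R → Fin 5 × Fin 3 → Fin w ⊕ (Fin 5 × R × Fin 3) :=
    fun x y p => Sum.inr (p.1, L x y p.1, p.2)
  have hφ : ∀ x y, Function.Injective (φ x y) := by
    rintro x y ⟨i, z⟩ ⟨j, z'⟩ h
    simp only [φ, Sum.inr.injEq, Prod.mk.injEq] at h
    exact Prod.ext h.1 h.2.2
  let P : R × R → Finset (Finset (Fin w ⊕ (Fin 5 × R × Fin 3))) := fun q =>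
    (lineDesign (q.2 ∈ S)).image (Finset.image (φ q.1 q.2))
  have hPp : ∀ q, IsPacking (P q) := fun q =>
    (lineDesign_spec _).2.1.image (V := Finset.univ) (hφ q.1 q.2).injOn fun e _ =>
      Finset.subset_univ e
  have hPc : ∀ q, (P q).card = if q.2 ∈ S then 15 else 9 := fun q => by
    rw [← (lineDesign_spec (q.2 ∈ S)).1]
    exact Finset.card_image_of_injective _ (Finset.image_injective (hφ q.1 q.2))
  have hPmem : ∀ q, ∀ e ∈ P q, ∀ a ∈ e, ∃ i z, a = Sum.inr (i, L q.1 q.2 i, z) ∧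
      L q.1 q.2 i ∈ T i := by
    intro q e he a ha
    obtain ⟨d, hd, rfl⟩ := Finset.mem_image.1 he
    obtain ⟨⟨i, z⟩, hp, rfl⟩ := Finset.mem_image.1 ha
    refine ⟨i, z, rfl, ?_⟩
    by_cases hi : i = 4
    · subst hi
      simp only [T, if_true, hL₄]
      by_contra hq
      exact (lineDesign_spec _).2.2.2 hq d hd _ hp rfl
    · simp [T, hi]
  have hPtrans : ∀ q, ∀ e ∈ P q, ∀ i r r' z z', Sum.inr (i, r, z) ∈ e → Sum.inr (i, r', z') ∈ e →
      r = r' ∧ z = z' := by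
    intro q e he i r r' z z' ha hb
    obtain ⟨d, hd, rfl⟩ := Finset.mem_image.1 he
    obtain ⟨⟨j, u⟩, hp, h⟩ := Finset.mem_image.1 ha
    obtain ⟨⟨j', u'⟩, hp', h'⟩ := Finset.mem_image.1 hb
    simp only [φ, Sum.inr.injEq, Prod.mk.injEq] at h h'
    have := (lineDesign_spec _).2.2.1 d hd _ hp _ hp' (h.1.trans h'.1.symm)
    rw [Prod.mk.injEq] at this
    obtain ⟨rfl, rfl, rfl⟩ := h
    obtain ⟨-, rfl, rfl⟩ := h'
    exact ⟨by rw [this.1], this.2⟩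
  obtain ⟨hP, hPcard⟩ := IsPacking.biUnion (Finset.univ : Finset (R × R)) (B := P)
    (fun q _ => hPp q) (by
      rintro ⟨x, y⟩ - ⟨x', y'⟩ - hq e he f hf
      refine Finset.card_le_one.2 fun a ha b hb => ?_
      rw [Finset.mem_inter] at ha hb
      obtain ⟨i, z, rfl, -⟩ := hPmem _ e he a ha.1
      obtain ⟨j, u, rfl, -⟩ := hPmem _ e he b hb.1
      by_cases hij : i = j
      · subst hij
        rw [(hPtrans _ e he i _ _ z u ha.1 hb.1).2]
      · obtain ⟨i', z', h, -⟩ := hPmem _ f hf _ ha.2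
        obtain ⟨j', u', h', -⟩ := hPmem _ f hf _ hb.2
        simp only [Sum.inr.injEq, Prod.mk.injEq] at h h'
        obtain ⟨rfl, h, -⟩ := h
        obtain ⟨rfl, h', -⟩ := h'
        obtain ⟨rfl, rfl⟩ := hL x y x' y' i j hij h h'
        exact absurd rfl hq)
  have hPtotal : (Finset.univ.biUnion P).card = Fintype.card R * (9 * Fintype.card R + 6 * s) := by
    rw [hPcard, Finset.sum_congr rfl fun q _ => hPc q, Fintype.sum_prod_type]
    have : ∀ y, (if y ∈ S then 15 else 9) = 9 + if y ∈ S then 6 else 0 := fun y => by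
      split_ifs <;> rfl
    simp only [this, Finset.sum_add_distrib, Finset.sum_ite_mem, Finset.univ_inter, hS,
      Finset.sum_const, Finset.card_univ, smul_eq_mul]
    ring
  have hfill : ∀ i, ∃ C : Finset (Finset (Fin w ⊕ (Fin 5 × R × Fin 3))), IsPacking C ∧
      (∀ e ∈ C, e ⊆ G i ∧ (i ≠ 4 → (e ∩ W).card ≤ 1)) ∧
      (if i = 4 then N₂ else N₁) ≤ C.card := by
    intro i
    by_cases hi : i = 4
    · obtain ⟨C, hC, hCV, hCN⟩ := h₂.transfer (Finset.empty_subset (G i))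
        (by simp [hGc, T, hi, hS]) rfl
      exact ⟨C, hC, fun e he => ⟨(hCV e he).1, fun h => absurd hi h⟩, by rwa [if_pos hi]⟩
    · obtain ⟨C, hC, hCV, hCN⟩ := h₁.transfer (hWG i)
        (by simp [hGc, T, hi]) hW
      exact ⟨C, hC, fun e he => ⟨(hCV e he).1, fun _ => (hCV e he).2⟩, by rwa [if_neg hi]⟩
  choose C hC hCG hCN using hfill
  obtain ⟨hCp, hCcard⟩ := IsPacking.biUnion (Finset.univ : Finset (Fin 5)) (B := C)
    (fun i _ => hC i) (by
      intro i _ j _ hij e he f hf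
      have hsub : e ∩ f ⊆ W := by
        rintro (a | ⟨k, r, z⟩) ha
        · simp [W]
        · rw [Finset.mem_inter] at ha
          have h₁ := (hCG i e he).1 ha.1
          have h₂ := (hCG j f hf).1 ha.2
          simp only [G, Finset.inr_mem_disjSum, Finset.mem_product, Finset.mem_singleton] at h₁ h₂
          exact absurd (h₁.1.symm.trans h₂.1) hij
      by_cases hi : i = 4
      · exact (Finset.card_le_card (Finset.subset_inter Finset.inter_subset_right hsub)).trans
          ((hCG j f hf).2 fun hj => hij (hi.trans hj.symm))
      · exact (Finset.card_le_card (Finset.subset_inter Finset.inter_subset_left hsub)).trans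
          ((hCG i e he).2 hi))
  have hCtotal : 4 * N₁ + N₂ ≤ (Finset.univ.biUnion C).card := by
    rw [hCcard]
    refine le_trans ?_ (Finset.sum_le_sum fun i _ => hCN i)
    simp [Fin.sum_univ_five]
    omega
  obtain ⟨hU, hUcard⟩ := hP.union hCp (by
    intro e he f hf
    obtain ⟨q, -, he⟩ := Finset.mem_biUnion.1 he
    obtain ⟨k, -, hf⟩ := Finset.mem_biUnion.1 hf
    refine Finset.card_le_one.2 fun a ha b hb => ?_
    rw [Finset.mem_inter] at ha hb
    obtain ⟨i, z, rfl, -⟩ := hPmem _ e he a ha.1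
    obtain ⟨j, u, rfl, -⟩ := hPmem _ e he b hb.1
    have h₁ := (hCG k f hf).1 ha.2
    have h₂ := (hCG k f hf).1 hb.2
    simp only [G, Finset.inr_mem_disjSum, Finset.mem_product, Finset.mem_singleton] at h₁ h₂
    obtain rfl : i = j := h₁.1.trans h₂.1.symm
    rw [(hPtrans _ e he i _ _ z u ha.1 hb.1).2])
  refine ⟨_, inferInstance, V, ∅, _, Finset.empty_subset V, hVc, rfl, hU, ?_, ?_⟩
  · intro e he
    refine ⟨fun a ha => ?_, by simp⟩
    rcases Finset.mem_union.1 he with he | he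
    · obtain ⟨q, -, he⟩ := Finset.mem_biUnion.1 he
      obtain ⟨i, z, rfl, hi⟩ := hPmem q e he a ha
      simp [V, hi]
    · obtain ⟨i, -, he⟩ := Finset.mem_biUnion.1 he
      exact hGV i ((hCG i e he).1 ha)
  · omega

/-- There is a transversal design with five groups of size `t`, given by its lines `L x y`. -/
def IsTransversalOrder (t : ℕ) : Prop :=
  ∃ (R : Type) (_ : Fintype R) (_ : DecidableEq R) (L : R → R → Fin 5 → R), Fintype.card R = t ∧
    (∀ x y, L x y 4 = y) ∧
    ∀ x y x' y' i j, i ≠ j → L x y i = L x' y' i → L x y j = L x' y' j → x = x' ∧ y = y'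

theorem isTransversalOrder_of_isUnit {R : Type} [CommRing R] [Finite R] (f : Fin 5 → R)
    (hf : ∀ i j, i ≠ j → i ≠ 4 → j ≠ 4 → IsUnit (f i - f j)) :
    IsTransversalOrder (Nat.card R) := by
  classical
  refine ⟨R, Fintype.ofFinite R, inferInstance, fun x y i => if i = 4 then y else x + f i * y,
    (@Nat.card_eq_fintype_card R (Fintype.ofFinite R)).symm, fun x y => if_pos rfl, ?_⟩
  intro x y x' y' i j hij h₁ h₂
  by_cases hi : i = 4
  · have hj : j ≠ 4 := fun hj => hij (hi.trans hj.symm)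
    simp only [if_pos hi, if_neg hj] at h₁ h₂
    subst h₁
    exact ⟨add_right_cancel h₂, rfl⟩
  · by_cases hj : j = 4
    · simp only [if_neg hi, if_pos hj] at h₁ h₂
      subst h₂
      exact ⟨add_right_cancel h₁, rfl⟩
    · simp only [if_neg hi, if_neg hj] at h₁ h₂
      have hy : y = y' := by
        refine (hf i j hij hi hj).mul_left_cancel ?_
        linear_combination h₁ - h₂
      subst hy
      exact ⟨add_right_cancel h₁, rfl⟩

theorem isTransversalOrder_of_coprime {t : ℕ} (ht : t.Coprime 6) : IsTransversalOrder t := by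
  have ht₀ : t ≠ 0 := by
    rintro rfl
    revert ht
    decide
  have : NeZero t := ⟨ht₀⟩
  have hunit : ∀ d : ℕ, d ∣ 6 → IsUnit (d : ZMod t) := fun d hd =>
    (ZMod.isUnit_iff_coprime d t).2 (ht.symm.coprime_dvd_left hd)
  have h₁ : IsUnit (1 : ZMod t) := isUnit_one
  have h₂ : IsUnit (2 : ZMod t) := by simpa using hunit 2 (by decide)
  have h₃ : IsUnit (3 : ZMod t) := by simpa using hunit 3 (by decide)
  have := isTransversalOrder_of_isUnit (R := ZMod t) ![0, 1, 2, 3, 0] (by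
    intro i j hij hi hj
    fin_cases i <;> fin_cases j <;> first
      | exact absurd rfl hij
      | exact absurd rfl hi
      | exact absurd rfl hj
      | (norm_num <;> assumption))
  rwa [Nat.card_zmod] at this

theorem isTransversalOrder_of_prime_pow {p n : ℕ} (hp : p.Prime) (hn : n ≠ 0) (h : 4 ≤ p ^ n) :
    IsTransversalOrder (p ^ n) := by
  have : Fact p.Prime := ⟨hp⟩
  have : Fintype (GaloisField p n) := Fintype.ofFinite _
  rw [← GaloisField.card p n hn] at h ⊢
  obtain ⟨e⟩ := Function.Embedding.nonempty_of_card_le (α := Fin 4) (β := GaloisField p n)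
    (by rwa [Fintype.card_fin, ← Nat.card_eq_fintype_card])
  refine isTransversalOrder_of_isUnit (fun i => e (Fin.ofNat 4 i)) fun i j hij hi hj => ?_
  refine (sub_ne_zero.2 fun h => ?_).isUnit
  have hne : ∀ i j : Fin 5, i ≠ j → i ≠ 4 → j ≠ 4 → Fin.ofNat 4 i ≠ Fin.ofNat 4 j := by decide
  exact hne i j hij hi hj (e.injective h)

/-- There is a packing on `3 * r + 1 + c` points with at least `(r * (3 * r + 1) - d) / 4`
blocks. -/
def NearOptimal (r c d : ℕ) : Prop :=
  ∃ N, HasPacking (3 * r + 1 + c) 0 N ∧ r * (3 * r + 1) ≤ 4 * N + d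

theorem HasPacking.isolated_point {v N : ℕ} (h : HasPacking v 0 N) : HasPacking (v + 1) 0 N :=
  h.isolated_hole.forget_hole

theorem NearOptimal.mono {r c d d' : ℕ} (h : NearOptimal r c d) (hd : d ≤ d') :
    NearOptimal r c d' := by
  obtain ⟨N, h₁, h₂⟩ := h
  exact ⟨N, h₁, by omega⟩

theorem NearOptimal.isolated_point {r d : ℕ} (h : NearOptimal r 0 d) : NearOptimal r 1 d := by
  obtain ⟨N, h₁, h₂⟩ := h
  exact ⟨N, h₁.isolated_point, h₂⟩

theorem HasPacking.fill_isTransversalOrder {t s w N₁ N₂ : ℕ} (ht : IsTransversalOrder t)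
    (ht₀ : 0 < t) (hs : s ≤ t) (h₁ : HasPacking (3 * t + w) w N₁)
    (h₂ : HasPacking (3 * s + w) 0 N₂) :
    HasPacking (3 * (4 * t + s) + w) 0 (t * (9 * t + 6 * s) + 4 * N₁ + N₂) := by
  obtain ⟨R, _, _, L, rfl, hL₄, hL⟩ := ht
  have : Nonempty R := Fintype.card_pos_iff.1 ht₀
  exact h₁.fill_transversal L hL₄ hL hs h₂

/-- Filling in groups together with one common point (and `c ≤ 1` isolated points). -/
theorem NearOptimal.fill_point {t s c d : ℕ} (ht : IsTransversalOrder t) (ht₀ : 0 < t)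
    (hs : s ≤ t) (hc : c ≤ 1) (h₁ : NearOptimal t 0 0) (h₂ : NearOptimal s c d) :
    NearOptimal (4 * t + s) c d := by
  obtain ⟨N₁, hN₁, hN₁'⟩ := h₁
  obtain ⟨N₂, hN₂, hN₂'⟩ := h₂
  have hole : HasPacking (3 * t + (1 + c)) (1 + c) N₁ := by
    obtain rfl | rfl : c = 0 ∨ c = 1 := by omega
    · exact hN₁.point_hole (by omega)
    · exact (hN₁.point_hole (by omega)).isolated_hole
  have h := HasPacking.fill_isTransversalOrder ht ht₀ hs hole (by rwa [← add_assoc])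
  refine ⟨_, by rwa [add_assoc], ?_⟩
  nlinarith

/-- Filling in groups together with a common block (and `c ≤ 1` isolated points). -/
theorem NearOptimal.fill_block {t s c d : ℕ} (ht : IsTransversalOrder t) (ht₀ : 0 < t)
    (hs : s ≤ t) (hc : c ≤ 1) (h₁ : NearOptimal (t + 1) 0 0) (h₂ : NearOptimal (s + 1) c d) :
    NearOptimal (4 * t + s + 1) c d := by
  obtain ⟨N₁, hN₁, hN₁'⟩ := h₁
  obtain ⟨N₂, hN₂, hN₂'⟩ := h₂
  obtain ⟨M, rfl⟩ : ∃ M, N₁ = M + 1 := ⟨N₁ - 1, by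
    have : 0 < (t + 1) * (3 * (t + 1) + 1) := by positivity
    omega⟩
  have hole : HasPacking (3 * t + (4 + c)) (4 + c) M := by
    obtain rfl | rfl : c = 0 ∨ c = 1 := by omega
    · exact hN₁.block_hole
    · exact hN₁.block_hole.isolated_hole
  have h := HasPacking.fill_isTransversalOrder ht ht₀ hs hole
    (by rwa [show 3 * s + (4 + c) = 3 * (s + 1) + 1 + c by ring])
  refine ⟨_, by rwa [show 3 * (4 * t + s + 1) + 1 + c = 3 * (4 * t + s) + (4 + c) by ring], ?_⟩
  nlinarith

/-- The packings on `3 * r + 1` (and `3 * r + 2`) points used below, by the residue of `r`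
modulo four. -/
def PackingClaim (r : ℕ) : Prop :=
  (r % 4 ≤ 1 → NearOptimal r 0 0) ∧ (r % 4 = 3 → NearOptimal r 0 16) ∧
    (r % 4 = 2 → NearOptimal r 0 16 ∧ NearOptimal r 1 8)

theorem PackingClaim.fill_point {t s : ℕ} (ht : IsTransversalOrder t) (ht₀ : 0 < t)
    (ht₁ : t % 4 ≤ 1) (hs : s ≤ t) (h₁ : PackingClaim t) (h₂ : PackingClaim s) :
    PackingClaim (4 * t + s) :=
  have h := h₁.1 ht₁
  ⟨fun hr => .fill_point ht ht₀ hs (by omega) h (h₂.1 (by omega)),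
    fun hr => .fill_point ht ht₀ hs (by omega) h (h₂.2.1 (by omega)),
    fun hr => ⟨.fill_point ht ht₀ hs (by omega) h (h₂.2.2 (by omega)).1,
      .fill_point ht ht₀ hs (by omega) h (h₂.2.2 (by omega)).2⟩⟩

theorem PackingClaim.fill_block {t s : ℕ} (ht : IsTransversalOrder t) (ht₀ : 0 < t)
    (ht₁ : (t + 1) % 4 ≤ 1) (hs : s ≤ t) (h₁ : PackingClaim (t + 1))
    (h₂ : PackingClaim (s + 1)) : PackingClaim (4 * t + s + 1) :=
  have h := h₁.1 ht₁
  ⟨fun hr => .fill_block ht ht₀ hs (by omega) h (h₂.1 (by omega)),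
    fun hr => .fill_block ht ht₀ hs (by omega) h (h₂.2.1 (by omega)),
    fun hr => ⟨.fill_block ht ht₀ hs (by omega) h (h₂.2.2 (by omega)).1,
      .fill_block ht ht₀ hs (by omega) h (h₂.2.2 (by omega)).2⟩⟩

theorem packingClaim_of_exact {r N : ℕ} (hr : r % 4 ≤ 1) (h : HasPacking (3 * r + 1) 0 N)
    (hN : r * (3 * r + 1) ≤ 4 * N) : PackingClaim r :=
  ⟨fun _ => ⟨N, h, hN⟩, fun _ => by omega, fun _ => by omega⟩

theorem packingClaim_of_three {r N : ℕ} (hr : r % 4 = 3) (h : HasPacking (3 * r + 1) 0 N)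
    (hN : r * (3 * r + 1) ≤ 4 * N + 16) : PackingClaim r :=
  ⟨fun _ => by omega, fun _ => ⟨N, h, hN⟩, fun _ => by omega⟩

theorem packingClaim_of_two {r N : ℕ} (hr : r % 4 = 2) (h : HasPacking (3 * r + 1) 0 N)
    (hN : r * (3 * r + 1) ≤ 4 * N + 8) : PackingClaim r :=
  have h' : NearOptimal r 0 8 := ⟨N, h, hN⟩
  ⟨fun _ => by omega, fun _ => by omega, fun _ => ⟨h'.mono (by omega), h'.isolated_point⟩⟩

theorem hasPacking_one : HasPacking 1 0 0 :=
  hasPacking_develop 1 [1] [] (by decide +kernel)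

theorem hasPacking_four : HasPacking 4 0 1 :=
  hasPacking_develop 4 [4] [([0, 1, 2, 3], 1)] (by decide +kernel)

theorem packingClaim_of_base {r : ℕ} (hr : r < 16 ∨ 26 ≤ r ∧ r ≤ 28) : PackingClaim r := by
  obtain hr | rfl | rfl | rfl : r < 16 ∨ r = 26 ∨ r = 27 ∨ r = 28 := by omega
  · interval_cases r
    · exact packingClaim_of_exact (by decide) hasPacking_one (by decide)
    · exact packingClaim_of_exact (by decide) hasPacking_four (by decide)
    · exact packingClaim_of_two (by decide) hasPacking_7 (by decide)
    · exact packingClaim_of_three (by decide) hasPacking_10 (by decide)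
    · exact packingClaim_of_exact (by decide) hasPacking_13 (by decide)
    · exact packingClaim_of_exact (by decide) hasPacking_16 (by decide)
    · exact ⟨fun h => absurd h (by decide), fun h => absurd h (by decide), fun _ =>
        ⟨⟨25, hasPacking_19, by decide⟩, ⟨30, hasPacking_20, by decide⟩⟩⟩
    · exact packingClaim_of_three (by decide) hasPacking_22 (by decide)
    · exact packingClaim_of_exact (by decide) hasPacking_25 (by decide)
    · exact packingClaim_of_exact (by decide) hasPacking_28 (by decide)
    · exact packingClaim_of_two (by decide) hasPacking_31 (by decide)
    · exact packingClaim_of_three (by decide) hasPacking_34 (by decide)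
    · exact packingClaim_of_exact (by decide) hasPacking_37 (by decide)
    · exact packingClaim_of_exact (by decide) hasPacking_40 (by decide)
    · exact packingClaim_of_two (by decide) hasPacking_43 (by decide)
    · exact packingClaim_of_three (by decide) hasPacking_46 (by decide)
  · exact packingClaim_of_two (by decide) hasPacking_79 (by decide)
  · exact packingClaim_of_three (by decide) hasPacking_82 (by decide)
  · exact packingClaim_of_exact (by decide) hasPacking_85 (by decide)

/-- The conditions on `t` that allow `PackingClaim r` to be obtained by filling a truncated
transversal design of order `t`. -/
def Covers (t r : ℕ) : Prop :=
  (t.Coprime 6 ∨ t = 4 ∨ t = 8 ∨ t = 9 ∨ t = 16) ∧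
    (t % 4 ≤ 1 ∧ 4 * t ≤ r ∧ r ≤ 5 * t ∨ (t + 1) % 4 ≤ 1 ∧ 4 * t + 1 ≤ r ∧ r ≤ 5 * t + 1)

instance (t r : ℕ) : Decidable (Covers t r) := by
  unfold Covers
  infer_instance

theorem coprime_six_of_mod {t : ℕ} (h : t % 6 = 1 ∨ t % 6 = 5) : t.Coprime 6 := by
  rw [Nat.coprime_iff_gcd_eq_one, Nat.gcd_comm, Nat.gcd_rec]
  rcases h with h | h <;> rw [h] <;> rfl

theorem exists_covers {r : ℕ} (hr : 16 ≤ r) (hr' : ¬ (26 ≤ r ∧ r ≤ 28)) : ∃ t, Covers t r := by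
  by_cases h : r < 192
  · have key : ∀ r < 192, 16 ≤ r → ¬ (26 ≤ r ∧ r ≤ 28) → ∃ t < 49, Covers t r := by
      decide +kernel
    obtain ⟨t, -, ht⟩ := key r h hr hr'
    exact ⟨t, ht⟩
  · by_cases h₁ : 20 ≤ r % 48
    · exact ⟨12 * (r / 48) + 5, Or.inl (coprime_six_of_mod (by omega)), by omega⟩
    · by_cases h₂ : 4 ≤ r % 48
      · exact ⟨12 * (r / 48) + 1, Or.inl (coprime_six_of_mod (by omega)), by omega⟩
      · exact ⟨12 * (r / 48) - 7, Or.inl (coprime_six_of_mod (by omega)), by omega⟩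

theorem packingClaim (r : ℕ) : PackingClaim r := by
  induction r using Nat.strong_induction_on with
  | _ r ih =>
    by_cases hr : r < 16 ∨ 26 ≤ r ∧ r ≤ 28
    · exact packingClaim_of_base hr
    · obtain ⟨t, ht, hcov⟩ := exists_covers (r := r) (by omega) (by omega)
      have hT : IsTransversalOrder t := by
        rcases ht with ht | rfl | rfl | rfl | rfl
        · exact isTransversalOrder_of_coprime ht
        · exact isTransversalOrder_of_prime_pow (p := 2) (n := 2) (by norm_num) (by omega)
            (by norm_num)
        · exact isTransversalOrder_of_prime_pow (p := 2) (n := 3) (by norm_num) (by omega)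
            (by norm_num)
        · exact isTransversalOrder_of_prime_pow (p := 3) (n := 2) (by norm_num) (by omega)
            (by norm_num)
        · exact isTransversalOrder_of_prime_pow (p := 2) (n := 4) (by norm_num) (by omega)
            (by norm_num)
      rcases hcov with ⟨h₁, h₂, h₃⟩ | ⟨h₁, h₂, h₃⟩
      · obtain ⟨s, rfl⟩ := Nat.exists_eq_add_of_le h₂
        exact .fill_point hT (by omega) h₁ (by omega) (ih t (by omega)) (ih s (by omega))
      · obtain ⟨s, rfl⟩ := Nat.exists_eq_add_of_le h₂
        rw [show 4 * t + 1 + s = 4 * t + s + 1 by ring]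
        exact .fill_block hT (by omega) h₁ (by omega) (ih (t + 1) (by omega))
          (ih (s + 1) (by omega))

theorem exists_hasPacking (a : ℕ) : ∃ N, HasPacking a 0 N ∧
    a * a + 12 * (if a % 2 = 0 then a % 3 else 0) ≤ 12 * N + 48 + 3 * a := by
  obtain ⟨h₁, h₂, h₃⟩ := packingClaim (a / 3)
  generalize hr : a / 3 = r at h₁ h₂ h₃
  have hcases : r % 4 ≤ 1 ∨ r % 4 = 3 ∨ r % 4 = 2 := by omega
  have h16 : NearOptimal r 0 16 := by
    rcases hcases with h | h | h
    exacts [(h₁ h).mono (by omega), h₂ h, (h₃ h).1]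
  obtain rfl | rfl | rfl : a = 3 * r ∨ a = 3 * r + 1 ∨ a = 3 * r + 2 := by omega
  · obtain ⟨N, hN, hN'⟩ := h16
    refine ⟨N - r, hN.delete_point, ?_⟩
    have : (if 3 * r % 2 = 0 then 3 * r % 3 else 0) = 0 := by split_ifs <;> omega
    rw [this]
    have : N ≤ N - r + r := by omega
    nlinarith
  · rcases Nat.eq_zero_or_pos (r % 2) with hr2 | hr2
    · obtain ⟨N, hN, hN'⟩ := h16
      refine ⟨N, hN, ?_⟩
      rw [if_neg (by omega)]
      nlinarith
    · rw [if_pos (by omega), show (3 * r + 1) % 3 = 1 by omega]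
      by_cases h : r = 1
      · obtain ⟨N, hN, hN'⟩ := h₁ (by omega)
        exact ⟨N, hN, by nlinarith⟩
      · obtain ⟨N, hN, hN'⟩ := h16
        have : 3 ≤ r := by omega
        exact ⟨N, hN, by nlinarith⟩
  · rcases Nat.eq_zero_or_pos (r % 2) with hr2 | hr2
    · have h8 : NearOptimal r 1 8 := by
        rcases hcases with h | h | h
        exacts [((h₁ h).mono (by omega)).isolated_point, by omega, (h₃ h).2]
      obtain ⟨N, hN, hN'⟩ := h8
      refine ⟨N, hN, ?_⟩
      rw [if_pos (by omega), show (3 * r + 2) % 3 = 2 by omega]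
      nlinarith
    · obtain ⟨N, hN, hN'⟩ := h16.isolated_point
      refine ⟨N, hN, ?_⟩
      rw [if_neg (by omega)]
      nlinarith

theorem ZMod.eq_or_eq_add_of_intCast_eq {q : ℕ} {x y : ℤ} (h : (x : ZMod q) = y)
    (h₁ : x - y < 2 * q) (h₂ : y - x < 2 * q) : x = y ∨ x = y + q ∨ y = x + q := by
  obtain ⟨m, hm⟩ := (ZMod.intCast_eq_intCast_iff_dvd_sub x y q).1 h
  have hm₁ : m < 2 := by nlinarith
  have hm₂ : -2 < m := by nlinarith
  interval_cases m <;> omega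

/-- The offsets of three rows such that the difference of any two rows is injective in `i`. -/
def offset (q i : ℕ) (k : Fin 3) : ℕ :=
  ![0, i, 2 * i + if q % 2 = 0 ∧ q ≤ 2 * i then 1 else 0] k

theorem eq_of_offset_add_eq {q i j : ℕ} (hi : i < q) (hj : j < q)
    (hi' : q % 2 = 0 → i + 1 < q) (hj' : q % 2 = 0 → j + 1 < q) {k l : Fin 3} (hkl : k ≠ l)
    (h : (offset q i k : ZMod q) + offset q j l = offset q j k + offset q i l) : i = j := by
  have h' : (((offset q i k + offset q j l : ℕ) : ℤ) : ZMod q) =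
      (((offset q j k + offset q i l : ℕ) : ℤ) : ZMod q) := by
    push_cast
    exact h
  have := ZMod.eq_or_eq_add_of_intCast_eq h'
  fin_cases k <;> fin_cases l <;> simp [offset] at this hkl <;> omega

section Cross

variable {a q : ℕ}

/-- The set of points on the first side. -/
def leftPoints (a q : ℕ) : Finset (Fin a ⊕ Fin 3 × ZMod q) := Finset.univ.disjSum ∅

/-- The block joining `p.1` to one point in each of the three rows. -/
def crossBlock (p : Fin a × ZMod q) : Finset (Fin a ⊕ Fin 3 × ZMod q) :=
  Finset.disjSum {p.1} (Finset.univ.image fun k => (k, p.2 + offset q p.1 k))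

/-- The block joining `i` to three consecutive points of a row. -/
def rowBlock (i : Fin a) (p : Fin 3 × ℕ) : Finset (Fin a ⊕ Fin 3 × ZMod q) :=
  Finset.disjSum {i} (Finset.univ.image fun m : Fin 3 => (p.1, ((3 * p.2 + m.val : ℕ) : ZMod q)))

theorem inl_mem_crossBlock {p : Fin a × ZMod q} {i : Fin a} :
    Sum.inl i ∈ crossBlock p ↔ i = p.1 := by
  simp [crossBlock]

theorem inr_mem_crossBlock {p : Fin a × ZMod q} {k : Fin 3} {y : ZMod q} :
    Sum.inr (k, y) ∈ crossBlock p ↔ y = p.2 + offset q p.1 k := by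
  simp [crossBlock, eq_comm]

theorem inl_mem_rowBlock {i j : Fin a} {p : Fin 3 × ℕ} :
    (Sum.inl i : Fin a ⊕ Fin 3 × ZMod q) ∈ rowBlock j p ↔ i = j := by
  simp [rowBlock]

theorem inr_mem_rowBlock {j : Fin a} {p : Fin 3 × ℕ} {k : Fin 3} {y : ZMod q} :
    Sum.inr (k, y) ∈ rowBlock j p ↔
      k = p.1 ∧ ∃ m : Fin 3, y = ((3 * p.2 + m.val : ℕ) : ZMod q) := by
  simp only [rowBlock, Finset.inr_mem_disjSum, Finset.mem_image, Finset.mem_univ, true_and,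
    Prod.mk.injEq]
  grind

theorem card_crossBlock (p : Fin a × ZMod q) : (crossBlock p).card = 4 := by
  rw [crossBlock, Finset.card_disjSum, Finset.card_image_of_injective _ fun k l h => by
    simpa using congrArg Prod.fst h]
  simp

theorem natCast_zmod_inj {x y : ℕ} (hx : x < q) (hy : y < q) (h : (x : ZMod q) = y) : x = y := by
  rwa [ZMod.natCast_eq_natCast_iff', Nat.mod_eq_of_lt hx, Nat.mod_eq_of_lt hy] at h

theorem card_rowBlock (i : Fin a) {p : Fin 3 × ℕ} (hp : p.2 < q / 3) :
    (rowBlock i p : Finset (Fin a ⊕ Fin 3 × ZMod q)).card = 4 := by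
  rw [rowBlock, Finset.card_disjSum, Finset.card_image_of_injective]
  · simp
  · intro m m' h
    have := natCast_zmod_inj (by omega) (by omega) (congrArg Prod.snd h)
    omega

theorem card_crossBlock_inter {p p' : Fin a × ZMod q} (hp : p.1.val < q) (hp' : p'.1.val < q)
    (h : q % 2 = 0 → p.1.val + 1 < q) (h' : q % 2 = 0 → p'.1.val + 1 < q) (hne : p ≠ p') :
    (crossBlock p ∩ crossBlock p').card ≤ 1 := by
  obtain ⟨i, x⟩ := p
  obtain ⟨i', x'⟩ := p'
  refine Finset.card_le_one.2 ?_
  rintro (j | ⟨k, y⟩) hu (j' | ⟨l, z⟩) hv <;>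
    simp only [Finset.mem_inter, inl_mem_crossBlock, inr_mem_crossBlock] at hu hv
  · rw [hu.1, hv.1]
  · obtain rfl : i = i' := hu.1.symm.trans hu.2
    exact absurd (by rw [add_right_cancel (hv.1.symm.trans hv.2)]) hne
  · obtain rfl : i = i' := hv.1.symm.trans hv.2
    exact absurd (by rw [add_right_cancel (hu.1.symm.trans hu.2)]) hne
  · by_cases hkl : k = l
    · subst hkl
      rw [hu.1, hv.1]
    · have : i.val = i'.val := eq_of_offset_add_eq hp hp' h h' hkl (by
        linear_combination hu.2 - hu.1 + hv.1 - hv.2)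
      obtain rfl : i = i' := Fin.ext this
      exact absurd (by rw [add_right_cancel (hu.1.symm.trans hu.2)]) hne

theorem card_rowBlock_inter {i : Fin a} {p p' : Fin 3 × ℕ} (hp : p.2 < q / 3) (hp' : p'.2 < q / 3)
    (hne : p ≠ p') :
    (rowBlock i p ∩ rowBlock i p' : Finset (Fin a ⊕ Fin 3 × ZMod q)).card ≤ 1 := by
  have hinr : ∀ k y, Sum.inr (k, y) ∉ (rowBlock i p ∩ rowBlock i p' :
      Finset (Fin a ⊕ Fin 3 × ZMod q)) := by
    intro k y hu
    simp only [Finset.mem_inter, inr_mem_rowBlock] at hu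
    obtain ⟨⟨h₁, m, hm⟩, h₂, m', hm'⟩ := hu
    have := natCast_zmod_inj (by omega) (by omega) (hm.symm.trans hm')
    exact hne (Prod.ext (h₁.symm.trans h₂) (by omega))
  refine Finset.card_le_one.2 ?_
  rintro (j | ⟨k, y⟩) hu (j' | ⟨l, z⟩) hv
  · simp only [Finset.mem_inter, inl_mem_rowBlock] at hu hv
    rw [hu.1, hv.1]
  · exact absurd hv (hinr _ _)
  · exact absurd hu (hinr _ _)
  · exact absurd hu (hinr _ _)

theorem card_crossBlock_inter_rowBlock {p : Fin a × ZMod q} {i : Fin a} {p' : Fin 3 × ℕ}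
    (hi : p.1 ≠ i) : (crossBlock p ∩ rowBlock i p').card ≤ 1 := by
  refine Finset.card_le_one.2 ?_
  rintro (j | ⟨k, y⟩) hu (j' | ⟨l, z⟩) hv <;>
    simp only [Finset.mem_inter, inl_mem_crossBlock, inr_mem_crossBlock, inl_mem_rowBlock,
      inr_mem_rowBlock] at hu hv
  · rw [hu.1, hv.1]
  · exact absurd (hu.1.symm.trans hu.2) hi
  · exact absurd (hv.1.symm.trans hv.2) hi
  · obtain rfl : k = l := hu.2.1.trans hv.2.1.symm
    rw [hu.1, hv.1]

theorem disjSum_singleton_inter_leftPoints (i : Fin a) (s : Finset (Fin 3 × ZMod q)) :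
    Finset.disjSum {i} s ∩ leftPoints a q = {Sum.inl i} := by
  ext (j | x) <;> simp [leftPoints]

theorem exists_cross_packing (ha : 0 < a) (haq : a ≤ q) :
    ∃ C : Finset (Finset (Fin a ⊕ Fin 3 × ZMod q)), IsPacking C ∧
      (∀ e ∈ C, (e ∩ leftPoints a q).card = 1) ∧
      a * q ≤ C.card + if a % 2 = 0 then a % 3 else 0 := by
  have : NeZero q := ⟨by omega⟩
  by_cases hmid : a = q ∧ q % 2 = 0
  · obtain ⟨rfl, heven⟩ := hmid
    obtain ⟨b, rfl⟩ : ∃ b, a = b + 1 := ⟨a - 1, by omega⟩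
    obtain ⟨h₁, h₁c⟩ := isPacking_image_of_family
      ((Finset.univ.erase (Fin.last b)) ×ˢ (Finset.univ : Finset (ZMod (b + 1)))) crossBlock
      (fun p _ => card_crossBlock p) (by
        intro p hp p' hp' hne
        have hlt : ∀ p ∈ (Finset.univ.erase (Fin.last b)) ×ˢ (Finset.univ : Finset (ZMod (b + 1))),
            p.1.val + 1 < b + 1 := by
          intro p hp
          simp only [Finset.mem_product, Finset.mem_erase, Finset.mem_univ, and_true] at hp
          have := Fin.val_lt_last hp
          omega
        exact card_crossBlock_inter p.1.isLt p'.1.isLt (fun _ => hlt p hp)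
          (fun _ => hlt p' hp') hne)
    obtain ⟨h₂, h₂c⟩ := isPacking_image_of_family
      ((Finset.univ : Finset (Fin 3)) ×ˢ Finset.range ((b + 1) / 3))
      (rowBlock (q := b + 1) (Fin.last b))
      (fun p hp => card_rowBlock _ (by simpa using hp))
      (fun p hp p' hp' => card_rowBlock_inter (by simpa using hp) (by simpa using hp'))
    obtain ⟨h₃, h₃c⟩ := h₁.union h₂ (by
      intro e he f hf
      obtain ⟨p, hp, rfl⟩ := Finset.mem_image.1 he
      obtain ⟨p', -, rfl⟩ := Finset.mem_image.1 hf
      simp only [Finset.mem_product, Finset.mem_erase, Finset.mem_univ, and_true] at hp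
      exact card_crossBlock_inter_rowBlock hp)
    refine ⟨_, h₃, ?_, ?_⟩
    · intro e he
      rcases Finset.mem_union.1 he with he | he
      · obtain ⟨p, -, rfl⟩ := Finset.mem_image.1 he
        rw [crossBlock, disjSum_singleton_inter_leftPoints, Finset.card_singleton]
      · obtain ⟨p, -, rfl⟩ := Finset.mem_image.1 he
        rw [rowBlock, disjSum_singleton_inter_leftPoints, Finset.card_singleton]
    · rw [h₃c, h₁c, h₂c, Finset.card_product, Finset.card_product, Finset.card_range,
        Finset.card_erase_of_mem (Finset.mem_univ _), if_pos heven]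
      simp only [Finset.card_univ, Fintype.card_fin, ZMod.card, Nat.add_sub_cancel]
      have := Nat.div_add_mod (b + 1) 3
      nlinarith
  · obtain ⟨h₁, h₁c⟩ := isPacking_image_of_family (Finset.univ : Finset (Fin a × ZMod q)) crossBlock
      (fun p _ => card_crossBlock p) (fun p _ p' _ => by
        have h₁ := p.1.isLt
        have h₂ := p'.1.isLt
        exact card_crossBlock_inter (by omega) (by omega) (by omega) (by omega))
    refine ⟨_, h₁, ?_, ?_⟩
    · intro e he
      obtain ⟨p, -, rfl⟩ := Finset.mem_image.1 he
      rw [crossBlock, disjSum_singleton_inter_leftPoints, Finset.card_singleton]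
    · rw [h₁c]
      simp

end Cross

theorem card_le_g {α : Type} [DecidableEq α] [Fintype α] {n k : ℕ} (hα : Fintype.card α ≤ n)
    {B : Finset (Finset α)} (hB : IsPacking B) {A : Finset α} (hA : A.card = k - 1)
    (hBA : ∀ e ∈ B, (e ∩ A).Nonempty) : B.card ≤ g n k := by
  obtain ⟨φ⟩ := Function.Embedding.nonempty_of_card_le (α := α) (β := Fin n) (by simpa using hα)
  have himg := hB.image (V := Finset.univ) φ.injective.injOn fun e _ => Finset.subset_univ e
  refine le_csSup ⟨Fintype.card (Finset (Fin n)), ?_⟩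
    ⟨⟨B.image (Finset.image φ), himg.1, himg.2⟩, A.image φ, ?_, ?_⟩
  · rintro m ⟨H, A, -, rfl⟩
    exact Finset.card_le_univ _
  · rw [Finset.card_image_of_injective _ φ.injective, hA]
  · rw [Finset.filter_true_of_mem, Finset.card_image_of_injective _
      (Finset.image_injective φ.injective)]
    intro e he
    obtain ⟨d, hd, rfl⟩ := Finset.mem_image.1 he
    rw [← Finset.image_inter _ _ φ.injective]
    exact (hBA d hd).image φ

theorem exists_le_g {a q n : ℕ} (ha : 0 < a) (haq : a ≤ q) (hn : a + 3 * q ≤ n) :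
    12 * (a * q) + a * a ≤ 12 * g n (a + 1) + 48 + 3 * a := by
  have : NeZero q := ⟨by omega⟩
  have : Nonempty (Fin a) := ⟨⟨0, ha⟩⟩
  obtain ⟨N, hN, hN'⟩ := exists_hasPacking a
  obtain ⟨C, hC, hCA, hCc⟩ := exists_cross_packing ha haq
  obtain ⟨B, hB, hBA, hBN⟩ := hN.transfer (Finset.empty_subset (leftPoints a q))
    (by simp [leftPoints]) rfl
  obtain ⟨hU, hUc⟩ := hC.union hB fun e he f hf =>
    (Finset.card_le_card (Finset.inter_subset_inter_left (hBA f hf).1)).trans (hCA e he).le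
  have := card_le_g (n := n) (k := a + 1) (by simpa [mul_comm] using hn) hU
    (A := leftPoints a q) (by simp [leftPoints]) (by
      intro e he
      rw [← Finset.card_pos]
      rcases Finset.mem_union.1 he with he | he
      · rw [hCA e he]
        exact Nat.one_pos
      · rw [Finset.inter_eq_left.2 (hBA e he).1, hB.1 e he]
        exact Nat.succ_pos 3)
  omega

/-- for `k ≥ 1` and `n ≥ 4k - 4`,
`g(n,k) ≥ (k-1)⌊(n-k+1)/3⌋ + C(k-1,2)/6 - 7/2 - (k+2)/6`. -/
theorem g_lower (k n : ℕ) (hk : 1 ≤ k) (hn : 4 * k - 4 ≤ n) :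
    ((k : ℚ) - 1) * (⌊((n : ℚ) - k + 1) / 3⌋ : ℚ)
      + ((k : ℚ) - 1) * ((k : ℚ) - 2) / 2 / 6 - 7 / 2 - ((k : ℚ) + 2) / 6
    ≤ (g n k : ℚ) := by
  obtain ⟨a, rfl⟩ : ∃ a, k = a + 1 := ⟨k - 1, by omega⟩
  have hfloor : ⌊((n : ℚ) - (a + 1 : ℕ) + 1) / 3⌋ = (((n - a) / 3 : ℕ) : ℤ) := by
    obtain ⟨m, rfl⟩ : ∃ m, n = a + m := ⟨n - a, by omega⟩
    rw [Nat.add_sub_cancel_left, show ((a + m : ℕ) : ℚ) - (a + 1 : ℕ) + 1 = (m : ℚ) by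
      push_cast
      ring]
    exact_mod_cast Rat.floor_natCast_div_natCast m 3
  rw [hfloor]
  rcases Nat.eq_zero_or_pos a with rfl | ha
  · have : (0 : ℚ) ≤ g n (0 + 1) := Nat.cast_nonneg _
    push_cast
    linarith
  · have h := exists_le_g (q := (n - a) / 3) (n := n) ha (by omega) (by omega)
    have h' : (12 : ℚ) * (a * ((n - a) / 3 : ℕ)) + a * a ≤ 12 * g n (a + 1) + 48 + 3 * a := by
      exact_mod_cast h
    rw [Int.cast_natCast]
    push_cast at h' ⊢
    linarith
end

section
/- Let H be an E_4^+-free linear quadruple system and let e = {a, b, c, d} be a quadruple of H whose vertex degrees satisfy d(a) ≥ d(b) ≥ d(c) ≥ d(d), with d(c) ≥ 5 and d(d) ≥ 3. Then d(a) ≤ 7. -/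
/-- The degree of a vertex `v`: the number of quadruples of `H` containing `v`. -/
def degree {n : ℕ} (H : LinearQuadSystem n) (v : Fin n) : ℕ :=
  (H.edges.filter (fun e => v ∈ e)).card

/-- `H` contains `E_4^+`: three pairwise disjoint quadruples `e₁, e₂, e₃` together
with a fourth quadruple `f` meeting each of them in exactly one vertex. -/
def ContainsE4plus {n : ℕ} (H : LinearQuadSystem n) : Prop :=
  ∃ e₁ e₂ e₃ f : Finset (Fin n),
    e₁ ∈ H.edges ∧ e₂ ∈ H.edges ∧ e₃ ∈ H.edges ∧ f ∈ H.edges ∧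
    Disjoint e₁ e₂ ∧ Disjoint e₁ e₃ ∧ Disjoint e₂ e₃ ∧
    (f ∩ e₁).card = 1 ∧ (f ∩ e₂).card = 1 ∧ (f ∩ e₃).card = 1

namespace LinearQuadSystem

variable {n : ℕ} (H : LinearQuadSystem n)

/-- Two quadruples that share two distinct vertices are equal. -/
theorem eq_of_mem_of_mem {e f : Finset (Fin n)} (he : e ∈ H.edges) (hf : f ∈ H.edges)
    {v w : Fin n} (hvw : v ≠ w) (hve : v ∈ e) (hwe : w ∈ e) (hvf : v ∈ f) (hwf : w ∈ f) :
    e = f := by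
  by_contra hne
  exact hvw (Finset.card_le_one.mp (H.linear e he f hf hne) v
    (Finset.mem_inter.mpr ⟨hve, hvf⟩) w (Finset.mem_inter.mpr ⟨hwe, hwf⟩))

theorem card_inter_eq_one {e f : Finset (Fin n)} (he : e ∈ H.edges) (hf : f ∈ H.edges)
    (hne : e ≠ f) {v : Fin n} (hve : v ∈ e) (hvf : v ∈ f) : (e ∩ f).card = 1 :=
  le_antisymm (H.linear e he f hf hne)
    (Finset.card_pos.mpr ⟨v, Finset.mem_inter.mpr ⟨hve, hvf⟩⟩)

theorem card_sdiff_le_three {e g : Finset (Fin n)} (hg : g ∈ H.edges) {v : Fin n}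
    (hve : v ∈ e) (hvg : v ∈ g) : (g \ e).card ≤ 3 := by
  have hsub : g \ e ⊆ g.erase v := fun x hx => by
    rw [Finset.mem_sdiff] at hx
    exact Finset.mem_erase.mpr ⟨fun h => hx.2 (h ▸ hve), hx.1⟩
  have hcard := Finset.card_le_card hsub
  rwa [Finset.card_erase_of_mem hvg, H.card_four g hg] at hcard

/-- A vertex `v` of a quadruple `e` whose degree exceeds `|S \ e| + 1` lies on a quadruple
other than `e` that avoids `S`. -/
theorem exists_edge_disjoint {e : Finset (Fin n)} (he : e ∈ H.edges) {v : Fin n} (hve : v ∈ e)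
    {S : Finset (Fin n)} (hvS : v ∉ S) (hS : (S \ e).card + 1 < degree H v) :
    ∃ f ∈ H.edges, v ∈ f ∧ e ≠ f ∧ Disjoint S f := by
  by_contra! hcon
  have hmeet : ∀ f ∈ (H.edges.filter (fun f => v ∈ f)).erase e, ∃ x ∈ S \ e, x ∈ f := by
    intro f hf
    obtain ⟨hne, hf⟩ := Finset.mem_erase.mp hf
    obtain ⟨hf, hvf⟩ := Finset.mem_filter.mp hf
    obtain ⟨x, hxS, hxf⟩ := Finset.not_disjoint_iff.mp (hcon f hf hvf hne.symm)
    refine ⟨x, Finset.mem_sdiff.mpr ⟨hxS, fun hxe => hne ?_⟩, hxf⟩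
    exact H.eq_of_mem_of_mem hf he (fun h : v = x => hvS (h ▸ hxS)) hvf hxf hve hxe
  have : Nonempty (Fin n) := ⟨v⟩
  choose! φ hφS hφ using hmeet
  have hle := Finset.card_le_card_of_injOn φ hφS fun f hf f' hf' heq => by
    have hx := hφ f hf
    have hx' := hφ f' hf'
    have hxS := (Finset.mem_sdiff.mp (hφS f hf)).1
    rw [← heq] at hx'
    simp only [Finset.mem_coe, Finset.mem_erase, Finset.mem_filter] at hf hf'
    exact H.eq_of_mem_of_mem hf.2.1 hf'.2.1 (fun h : v = φ f => hvS (h ▸ hxS))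
      hf.2.2 hx hf'.2.2 hx'
  rw [Finset.card_erase_of_mem (Finset.mem_filter.mpr ⟨he, hve⟩)] at hle
  unfold degree at hS
  omega

end LinearQuadSystem

/-- in an `E_4^+`-free linear quadruple system, if `{a,b,c,d}` is a
quadruple with `d(a) ≥ d(b) ≥ d(c) ≥ d(d)`, `d(c) ≥ 5` and `d(d) ≥ 3`, then
`d(a) ≤ 7`. -/
theorem degree_bound_E4plus_free (n : ℕ) (H : LinearQuadSystem n)
    (hfree : ¬ ContainsE4plus H) (a b c d : Fin n)
    (he : ({a, b, c, d} : Finset (Fin n)) ∈ H.edges)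
    (hab : degree H b ≤ degree H a) (hbc : degree H c ≤ degree H b)
    (hcd : degree H d ≤ degree H c)
    (hc : 5 ≤ degree H c) (hd : 3 ≤ degree H d) :
    degree H a ≤ 7 := by
  by_contra! ha
  have hcard := H.card_four _ he
  have hac : a ≠ c := by
    rintro rfl
    have := Finset.card_le_three (a := a) (b := b) (c := d)
    have hs : ({a, b, a, d} : Finset (Fin n)) = {a, b, d} := by ext; simp; tauto
    rw [hs] at hcard
    omega
  have had : a ≠ d := by
    rintro rfl
    have := Finset.card_le_three (a := a) (b := b) (c := c)
    have hs : ({a, b, c, a} : Finset (Fin n)) = {a, b, c} := by ext; simp; tauto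
    rw [hs] at hcard
    omega
  have hcd' : c ≠ d := by
    rintro rfl
    have := Finset.card_le_three (a := a) (b := b) (c := c)
    have hs : ({a, b, c, c} : Finset (Fin n)) = {a, b, c} := by ext; simp
    rw [hs] at hcard
    omega
  have hae : a ∈ ({a, b, c, d} : Finset (Fin n)) := by simp
  have hce : c ∈ ({a, b, c, d} : Finset (Fin n)) := by simp
  have hde : d ∈ ({a, b, c, d} : Finset (Fin n)) := by simp
  generalize ({a, b, c, d} : Finset (Fin n)) = e at *
  obtain ⟨g, hg, hdg, heg, -⟩ :=
    H.exists_edge_disjoint he hde (S := ∅) (by simp) (by simp; omega)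
  have hcg : c ∉ g := fun h => heg (H.eq_of_mem_of_mem he hg hcd' hce hde h hdg)
  have hag : a ∉ g := fun h => heg (H.eq_of_mem_of_mem he hg had hae hde h hdg)
  have hg3 := H.card_sdiff_le_three hg hde hdg
  obtain ⟨h, hh, hch, heh, hgh⟩ := H.exists_edge_disjoint he hce hcg (by omega)
  have hah : a ∉ h := fun h' => heh (H.eq_of_mem_of_mem he hh hac hae hce h' hch)
  have hh3 := H.card_sdiff_le_three hh hce hch
  have hgh6 : ((g ∪ h) \ e).card ≤ 6 := by
    rw [Finset.union_sdiff_distrib]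
    exact (Finset.card_union_le _ _).trans (by omega)
  obtain ⟨k, hk, hak, hek, hghk⟩ :=
    H.exists_edge_disjoint he hae (S := g ∪ h) (by simp [hag, hah]) (by omega)
  rw [Finset.disjoint_union_left] at hghk
  exact hfree ⟨g, h, k, e, hg, hh, hk, he, hgh, hghk.1, hghk.2,
    H.card_inter_eq_one he hg heg hde hdg, H.card_inter_eq_one he hh heh hce hch,
    H.card_inter_eq_one he hk hek hae hak⟩
end

section
/- Let k ≥ 5 and let H be a P_k-free linear quadruple system containing a linear 4-path P with quadruples e_i = {x_{3i−2}, x_{3i−1}, x_{3i}, x_{3i+1}} for i = 1, …, k−1 (so P has distinct vertices x_1, …, x_{3k−2}). Then there is no touching pair in H: there do not exist quadruples f_1, f_2 of H such that f_1 contains an origin vertex, one internal vertex and two external vertices, f_2 contains a terminus vertex, one internal vertex and two external vertices, and the internal vertex of f_1 equals the internal vertex of f_2 and is of the form x_{3i−1} or x_{3i}. -/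
/-- `H` contains the linear 4-path `P_k`: quadruples `e 0, …, e (k-1)` with consecutive
quadruples meeting in exactly one vertex and non-consecutive quadruples disjoint. -/
def ContainsPath {n : ℕ} (k : ℕ) (H : LinearQuadSystem n) : Prop :=
  ∃ e : Fin k → Finset (Fin n),
    (∀ i, e i ∈ H.edges) ∧
    (∀ i j : Fin k, (i : ℕ) + 1 = (j : ℕ) → (e i ∩ e j).card = 1) ∧
    (∀ i j : Fin k, (i : ℕ) + 2 ≤ (j : ℕ) → e i ∩ e j = ∅)

/-- no touching pairs: let `k ≥ 5` and let `H` be a `P_k`-free linear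
quadruple system containing a path `P = P_{k-1}` with quadruples
`e_i = {x_{3i-2}, x_{3i-1}, x_{3i}, x_{3i+1}}` (`1 ≤ i ≤ k-1`) on distinct vertices
`x_1, …, x_{3k-2}`.  Then there are no quadruples `f₁, f₂` of `H` such that `f₁`
consists of an origin vertex `x_a` (`a ∈ {1,2,3}`), one internal vertex `x_j` and two
external vertices, `f₂` consists of a terminus vertex `x_b`
(`b ∈ {3k-4, 3k-3, 3k-2}`), the same internal vertex `x_j` and two external vertices,
where `x_j` is of the form `x_{3i-1}` or `x_{3i}`. -/
theorem no_touching_pair (n k : ℕ) (hk : 5 ≤ k) (H : LinearQuadSystem n)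
    (hfree : ¬ ContainsPath k H)
    (x : ℕ → Fin n) (hinj : Set.InjOn x (Set.Icc 1 (3 * k - 2)))
    (hP : ∀ i, 1 ≤ i → i ≤ k - 1 →
      ({x (3 * i - 2), x (3 * i - 1), x (3 * i), x (3 * i + 1)} : Finset (Fin n))
        ∈ H.edges) :
    ¬ ∃ (f₁ f₂ : Finset (Fin n)) (a b j : ℕ),
      f₁ ∈ H.edges ∧ f₂ ∈ H.edges ∧
      a ∈ ({1, 2, 3} : Set ℕ) ∧
      b ∈ ({3 * k - 4, 3 * k - 3, 3 * k - 2} : Set ℕ) ∧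
      4 ≤ j ∧ j ≤ 3 * k - 5 ∧
      (∃ i : ℕ, 1 ≤ i ∧ (j = 3 * i - 1 ∨ j = 3 * i)) ∧
      f₁ ∩ (Finset.Icc 1 (3 * k - 2)).image x = {x a, x j} ∧
      f₂ ∩ (Finset.Icc 1 (3 * k - 2)).image x = {x b, x j} := by
  rintro ⟨f₁, f₂, a, b, j, hf₁, hf₂, ha, hb, hj4, hj5, ⟨i, hi, hij⟩, h₁, h₂⟩
  simp only [Set.mem_insert_iff, Set.mem_singleton_iff] at ha hb
  have hinj' : ∀ s t, 1 ≤ s → s ≤ 3 * k - 2 → 1 ≤ t → t ≤ 3 * k - 2 → x s = x t → s = t :=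
    fun s t h1 h2 h3 h4 h => hinj ⟨h1, h2⟩ ⟨h3, h4⟩ h
  have hi2 : 2 ≤ i := by omega
  have hik : i + 2 ≤ k := by omega
  obtain ⟨E, hE⟩ : ∃ E : ℕ → Finset (Fin n),
      ∀ m, E m = {x (3 * m - 2), x (3 * m - 1), x (3 * m), x (3 * m + 1)} := ⟨_, fun _ => rfl⟩
  have hEmem : ∀ m z, 1 ≤ m → (z ∈ E m ↔ ∃ s, 3 * m - 2 ≤ s ∧ s ≤ 3 * m + 1 ∧ z = x s) := by
    intro m z hm
    simp only [hE, Finset.mem_insert, Finset.mem_singleton]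
    constructor
    · rintro (h | h | h | h)
      · exact ⟨_, by omega, by omega, h⟩
      · exact ⟨_, by omega, by omega, h⟩
      · exact ⟨_, by omega, by omega, h⟩
      · exact ⟨_, by omega, by omega, h⟩
    · rintro ⟨s, h1, h2, rfl⟩
      obtain rfl | rfl | rfl | rfl :
        s = 3 * m - 2 ∨ s = 3 * m - 1 ∨ s = 3 * m ∨ s = 3 * m + 1 := by omega
      all_goals simp
  have hEedge : ∀ m, 1 ≤ m → m ≤ k - 1 → E m ∈ H.edges := fun m h1 h2 => hE m ▸ hP m h1 h2
  have hmeet : ∀ (f : Finset (Fin n)) (c : ℕ), 1 ≤ c → c ≤ 3 * k - 2 →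
      f ∩ (Finset.Icc 1 (3 * k - 2)).image x = {x c, x j} →
      ∀ s, 1 ≤ s → s ≤ 3 * k - 2 → (x s ∈ f ↔ s = c ∨ s = j) := by
    intro f c hc1 hc2 hf s hs1 hs2
    have h := Finset.ext_iff.mp hf (x s)
    simp only [Finset.mem_inter, Finset.mem_image, Finset.mem_Icc, Finset.mem_insert,
      Finset.mem_singleton] at h
    refine (and_iff_left ⟨s, ⟨hs1, hs2⟩, rfl⟩).symm.trans (h.trans ?_)
    exact or_congr
      ⟨hinj' s c hs1 hs2 hc1 hc2, fun h => h ▸ rfl⟩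
      ⟨hinj' s j hs1 hs2 (by omega) (by omega), fun h => h ▸ rfl⟩
  have hm₁ := hmeet f₁ a (by omega) (by omega) h₁
  have hm₂ := hmeet f₂ b (by omega) (by omega) h₂
  have hEE : ∀ m, 1 ≤ m → m + 1 ≤ k - 1 → (E m ∩ E (m + 1)).card = 1 := by
    intro m h1 h2
    refine Finset.card_eq_one.mpr ⟨x (3 * m + 1), Finset.ext fun z => ?_⟩
    rw [Finset.mem_inter, hEmem m z h1, hEmem (m + 1) z (by omega), Finset.mem_singleton]
    constructor
    · rintro ⟨⟨s, hs1, hs2, rfl⟩, t, ht1, ht2, h⟩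
      have := hinj' s t (by omega) (by omega) (by omega) (by omega) h
      rw [show s = 3 * m + 1 by omega]
    · exact fun h => ⟨⟨_, by omega, by omega, h⟩, _, by omega, by omega, h⟩
  have hEd : ∀ m m', 1 ≤ m → m + 2 ≤ m' → m' ≤ k - 1 → E m ∩ E m' = ∅ := by
    intro m m' h1 h2 h3
    refine Finset.eq_empty_of_forall_notMem fun z hz => ?_
    rw [Finset.mem_inter, hEmem m z h1, hEmem m' z (by omega)] at hz
    obtain ⟨⟨s, hs1, hs2, rfl⟩, t, ht1, ht2, h⟩ := hz
    have := hinj' s t (by omega) (by omega) (by omega) (by omega) h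
    omega
  have hf₁E : (f₁ ∩ E 1).card = 1 := by
    refine Finset.card_eq_one.mpr ⟨x a, Finset.ext fun z => ?_⟩
    rw [Finset.mem_inter, hEmem 1 z le_rfl, Finset.mem_singleton]
    constructor
    · rintro ⟨hz, s, hs1, hs2, rfl⟩
      have := (hm₁ s (by omega) (by omega)).mp hz
      rw [show s = a by omega]
    · rintro rfl
      exact ⟨(hm₁ a (by omega) (by omega)).mpr (Or.inl rfl), a, by omega, by omega, rfl⟩
  have hf₂E : (f₂ ∩ E (k - 1)).card = 1 := by
    refine Finset.card_eq_one.mpr ⟨x b, Finset.ext fun z => ?_⟩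
    rw [Finset.mem_inter, hEmem (k - 1) z (by omega), Finset.mem_singleton]
    constructor
    · rintro ⟨hz, s, hs1, hs2, rfl⟩
      have := (hm₂ s (by omega) (by omega)).mp hz
      rw [show s = b by omega]
    · rintro rfl
      exact ⟨(hm₂ b (by omega) (by omega)).mpr (Or.inl rfl), b, by omega, by omega, rfl⟩
  have hf₁d : ∀ m, 2 ≤ m → m ≤ k - 1 → m ≠ i → f₁ ∩ E m = ∅ := by
    intro m hm1 hm2 hmi
    refine Finset.eq_empty_of_forall_notMem fun z hz => ?_
    rw [Finset.mem_inter, hEmem m z (by omega)] at hz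
    obtain ⟨hz, s, hs1, hs2, rfl⟩ := hz
    have := (hm₁ s (by omega) (by omega)).mp hz
    omega
  have hf₂d : ∀ m, 1 ≤ m → m ≤ k - 2 → m ≠ i → f₂ ∩ E m = ∅ := by
    intro m hm1 hm2 hmi
    refine Finset.eq_empty_of_forall_notMem fun z hz => ?_
    rw [Finset.mem_inter, hEmem m z (by omega)] at hz
    obtain ⟨hz, s, hs1, hs2, rfl⟩ := hz
    have := (hm₂ s (by omega) (by omega)).mp hz
    omega
  have hff : (f₁ ∩ f₂).card = 1 := by
    refine le_antisymm (H.linear f₁ hf₁ f₂ hf₂ ?_) (Finset.card_pos.mpr ⟨x j, ?_⟩)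
    · rintro rfl
      have := (hm₂ a (by omega) (by omega)).mp
        ((hm₁ a (by omega) (by omega)).mpr (Or.inl rfl))
      omega
    · exact Finset.mem_inter.mpr ⟨(hm₁ j (by omega) (by omega)).mpr (Or.inr rfl),
        (hm₂ j (by omega) (by omega)).mpr (Or.inr rfl)⟩
  -- The path `e_{i-1}, …, e_1, f₁, f₂, e_{k-1}, …, e_{i+1}` has `k` quadruples.
  obtain ⟨g, hg⟩ : ∃ g : ℕ → Finset (Fin n), ∀ t, g t =
      if t < i - 1 then E (i - 1 - t) else if t = i - 1 then f₁ else if t = i then f₂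
      else E (k + i - t) := ⟨_, fun _ => rfl⟩
  have hg₁ : ∀ t, t < i - 1 → g t = E (i - 1 - t) := fun t h => by rw [hg, if_pos h]
  have hg₂ : ∀ t, t = i - 1 → g t = f₁ := fun t h => by
    rw [hg, if_neg (by omega), if_pos h]
  have hg₃ : ∀ t, t = i → g t = f₂ := fun t h => by
    rw [hg, if_neg (by omega), if_neg (by omega), if_pos h]
  have hg₄ : ∀ t, i < t → g t = E (k + i - t) := fun t h => by
    rw [hg, if_neg (by omega), if_neg (by omega), if_neg (by omega)]
  have hcases : ∀ t, t < i - 1 ∨ t = i - 1 ∨ t = i ∨ i < t := fun t => by omega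
  refine hfree ⟨fun t => g t, fun ⟨t, ht⟩ => ?_, fun ⟨s, hs⟩ ⟨t, ht⟩ hst => ?_,
    fun ⟨s, hs⟩ ⟨t, ht⟩ hst => ?_⟩ <;> dsimp only at *
  · rcases hcases t with h | h | h | h
    · rw [hg₁ t h]; exact hEedge _ (by omega) (by omega)
    · rwa [hg₂ t h]
    · rwa [hg₃ t h]
    · rw [hg₄ t h]; exact hEedge _ (by omega) (by omega)
  · rcases hcases t with h | h | h | h
    · rw [hg₁ s (by omega), hg₁ t h, Finset.inter_comm,
        show i - 1 - s = i - 1 - t + 1 by omega]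
      exact hEE _ (by omega) (by omega)
    · rwa [hg₁ s (by omega), hg₂ t h, Finset.inter_comm, show i - 1 - s = 1 by omega]
    · rwa [hg₂ s (by omega), hg₃ t h]
    · rw [hg₄ t h]
      rcases Nat.lt_or_ge i s with h' | h'
      · rw [hg₄ s h', Finset.inter_comm, show k + i - s = k + i - t + 1 by omega]
        exact hEE _ (by omega) (by omega)
      · rwa [hg₃ s (by omega), show k + i - t = k - 1 by omega]
  · rcases hcases s with h | h | h | h
    · rw [hg₁ s h]
      rcases hcases t with h' | h' | h' | h'
      · rw [hg₁ t h', Finset.inter_comm]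
        exact hEd _ _ (by omega) (by omega) (by omega)
      · rw [hg₂ t h', Finset.inter_comm]
        exact hf₁d _ (by omega) (by omega) (by omega)
      · rw [hg₃ t h', Finset.inter_comm]
        exact hf₂d _ (by omega) (by omega) (by omega)
      · rw [hg₄ t h']
        exact hEd _ _ (by omega) (by omega) (by omega)
    · rw [hg₂ s h, hg₄ t (by omega)]
      exact hf₁d _ (by omega) (by omega) (by omega)
    · rw [hg₃ s h, hg₄ t (by omega)]
      exact hf₂d _ (by omega) (by omega) (by omega)
    · rw [hg₄ s h, hg₄ t (by omega), Finset.inter_comm]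
      exact hEd _ _ (by omega) (by omega) (by omega)
end

section
/- Let k ≥ 5 and let H be a P_k-free linear quadruple system containing a linear 4-path P with quadruples e_i = {x_{3i−2}, x_{3i−1}, x_{3i}, x_{3i+1}} for i = 1, …, k−1. Suppose f_1, f_2 are quadruples of H crossing over two consecutive internal vertices x_i, x_{i+1}: f_1 contains an origin vertex, the internal vertex x_{i+1} and two external vertices, and f_2 contains a terminus vertex, the internal vertex x_i and two external vertices. If i is not congruent to 2 modulo 3, then f_1 ∩ f_2 ≠ ∅. -/
open Finset in
/-- A set meeting the image of `s` in the image of `t` meets the image of `u ⊆ s` in that of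
`t ∩ u`. -/
theorem inter_image_eq_image_inter {α β : Type*} [DecidableEq α] [DecidableEq β]
    {x : α → β} {s t u : Finset α} {f : Finset β} (hx : Set.InjOn x s)
    (hf : f ∩ s.image x = t.image x) (ht : t ⊆ s) (hu : u ⊆ s) :
    f ∩ u.image x = (t ∩ u).image x := by
  rw [image_inter_of_injOn t u (hx.mono (by
      rw [← coe_union, coe_subset]; exact union_subset ht hu)), ← hf, inter_assoc,
    inter_eq_right.2 (image_subset_image hu)]

open Finset in
theorem Finset.pair_inter_Icc_eq_singleton {p q c d : ℕ} (hc : p ≤ c ∧ c ≤ q)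
    (hd : d < p ∨ q < d) : ({c, d} : Finset ℕ) ∩ Icc p q = {c} := by
  ext z
  simp only [mem_inter, mem_insert, mem_singleton, mem_Icc]
  omega

open Finset in
theorem Finset.pair_inter_Icc_eq_empty {p q c d : ℕ} (hc : c < p ∨ q < c)
    (hd : d < p ∨ q < d) : ({c, d} : Finset ℕ) ∩ Icc p q = ∅ := by
  ext z
  simp only [mem_inter, mem_insert, mem_singleton, mem_Icc, notMem_empty, iff_false]
  omega

/-- crossing pairs intersect: let `k ≥ 5` and let `H` be a `P_k`-free
linear quadruple system containing a path `P = P_{k-1}` with quadruples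
`e_i = {x_{3i-2}, x_{3i-1}, x_{3i}, x_{3i+1}}` (`1 ≤ i ≤ k-1`) on distinct vertices
`x_1, …, x_{3k-2}`.  Suppose `f₁, f₂ ∈ H` cross over the consecutive internal vertices
`x_i, x_{i+1}`: `f₁` consists of an origin vertex `x_a`, the internal vertex `x_{i+1}`
and two external vertices, and `f₂` consists of a terminus vertex `x_b`, the internal
vertex `x_i` and two external vertices.  If `i ≢ 2 (mod 3)` then `f₁ ∩ f₂ ≠ ∅`. -/
theorem crossing_pair_intersect (n k : ℕ) (hk : 5 ≤ k) (H : LinearQuadSystem n)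
    (hfree : ¬ ContainsPath k H)
    (x : ℕ → Fin n) (hinj : Set.InjOn x (Set.Icc 1 (3 * k - 2)))
    (hP : ∀ i, 1 ≤ i → i ≤ k - 1 →
      ({x (3 * i - 2), x (3 * i - 1), x (3 * i), x (3 * i + 1)} : Finset (Fin n))
        ∈ H.edges)
    (f₁ f₂ : Finset (Fin n)) (hf₁ : f₁ ∈ H.edges) (hf₂ : f₂ ∈ H.edges)
    (i : ℕ) (hi₁ : 4 ≤ i) (hi₂ : i + 1 ≤ 3 * k - 5)
    (a : ℕ) (ha : a ∈ ({1, 2, 3} : Set ℕ))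
    (b : ℕ) (hb : b ∈ ({3 * k - 4, 3 * k - 3, 3 * k - 2} : Set ℕ))
    (hfa : f₁ ∩ (Finset.Icc 1 (3 * k - 2)).image x = {x a, x (i + 1)})
    (hfb : f₂ ∩ (Finset.Icc 1 (3 * k - 2)).image x = {x b, x i})
    (hmod : i % 3 ≠ 2) :
    (f₁ ∩ f₂).Nonempty := by
  have hx : Set.InjOn x (Finset.Icc 1 (3 * k - 2) : Finset ℕ) := by rwa [Finset.coe_Icc]
  simp only [Set.mem_insert_iff, Set.mem_singleton_iff] at ha hb
  by_contra hne
  rw [Finset.not_nonempty_iff_eq_empty] at hne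
  have hne' : f₂ ∩ f₁ = ∅ := by rwa [Finset.inter_comm]
  let E : ℕ → Finset (Fin n) := fun m => (Finset.Icc (3 * m - 2) (3 * m + 1)).image x
  have hsub : ∀ m, 1 ≤ m → m ≤ k - 1 →
      Finset.Icc (3 * m - 2) (3 * m + 1) ⊆ Finset.Icc 1 (3 * k - 2) := fun m h₁ h₂ =>
    Finset.Icc_subset_Icc (by omega) (by omega)
  have hE : ∀ m, 1 ≤ m → m ≤ k - 1 → E m ∈ H.edges := by
    intro m h₁ h₂
    have hIcc : Finset.Icc (3 * m - 2) (3 * m + 1) =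
        {3 * m - 2, 3 * m - 1, 3 * m, 3 * m + 1} := by
      ext z
      simp only [Finset.mem_Icc, Finset.mem_insert, Finset.mem_singleton]
      omega
    simpa [E, hIcc, Finset.image_insert] using hP m h₁ h₂
  have hEE : ∀ m m', 1 ≤ m → m ≤ k - 1 → 1 ≤ m' → m' ≤ k - 1 → E m ∩ E m' =
      (Finset.Icc (3 * m - 2) (3 * m + 1) ∩ Finset.Icc (3 * m' - 2) (3 * m' + 1)).image x :=
    fun m m' h₁ h₂ h₃ h₄ => inter_image_eq_image_inter hx
      (by rw [Finset.inter_eq_left]; exact Finset.image_subset_image (hsub m h₁ h₂))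
      (hsub m h₁ h₂) (hsub m' h₃ h₄)
  have hadj : ∀ m m', m' = m + 1 → 1 ≤ m → m' ≤ k - 1 → (E m ∩ E m').card = 1 := by
    intro m m' h h₁ h₂
    have hIcc : Finset.Icc (3 * m - 2) (3 * m + 1) ∩ Finset.Icc (3 * m' - 2) (3 * m' + 1) =
        {3 * m + 1} := by
      ext z
      simp only [Finset.mem_inter, Finset.mem_Icc, Finset.mem_singleton]
      omega
    rw [hEE m m' h₁ (by omega) (by omega) h₂, hIcc, Finset.image_singleton,
      Finset.card_singleton]
  have hadj' : ∀ m m', m = m' + 1 → 1 ≤ m' → m ≤ k - 1 → (E m ∩ E m').card = 1 :=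
    fun m m' h h₁ h₂ => by rw [Finset.inter_comm]; exact hadj m' m h h₁ h₂
  have hfar : ∀ m m', (m + 2 ≤ m' ∨ m' + 2 ≤ m) → 1 ≤ m → m ≤ k - 1 → 1 ≤ m' → m' ≤ k - 1 →
      E m ∩ E m' = ∅ := by
    intro m m' h h₁ h₂ h₃ h₄
    have hIcc : Finset.Icc (3 * m - 2) (3 * m + 1) ∩ Finset.Icc (3 * m' - 2) (3 * m' + 1) =
        ∅ := by
      ext z
      simp only [Finset.mem_inter, Finset.mem_Icc, Finset.notMem_empty, iff_false]
      omega
    rw [hEE m m' h₁ h₂ h₃ h₄, hIcc, Finset.image_empty]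
  have hpair : ∀ {f : Finset (Fin n)} {c d : ℕ},
      f ∩ (Finset.Icc 1 (3 * k - 2)).image x = {x c, x d} →
      1 ≤ c → c ≤ 3 * k - 2 → 1 ≤ d → d ≤ 3 * k - 2 → ∀ m, 1 ≤ m → m ≤ k - 1 →
      f ∩ E m = (({c, d} : Finset ℕ) ∩ Finset.Icc (3 * m - 2) (3 * m + 1)).image x := by
    intro f c d hf hc hc' hd hd' m h₁ h₂
    refine inter_image_eq_image_inter hx
      (by rw [hf, Finset.image_insert, Finset.image_singleton]) ?_ (hsub m h₁ h₂)
    intro z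
    simp only [Finset.mem_insert, Finset.mem_singleton, Finset.mem_Icc]
    omega
  have hpair_one : ∀ {f : Finset (Fin n)} {c d : ℕ},
      f ∩ (Finset.Icc 1 (3 * k - 2)).image x = {x c, x d} →
      1 ≤ c → c ≤ 3 * k - 2 → 1 ≤ d → d ≤ 3 * k - 2 → ∀ m, 1 ≤ m → m ≤ k - 1 →
      (3 * m - 2 ≤ c ∧ c ≤ 3 * m + 1) → (d < 3 * m - 2 ∨ 3 * m + 1 < d) →
      (f ∩ E m).card = 1 := by
    intro f c d hf hc hc' hd hd' m h₁ h₂ h₃ h₄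
    rw [hpair hf hc hc' hd hd' m h₁ h₂, Finset.pair_inter_Icc_eq_singleton h₃ h₄,
      Finset.image_singleton, Finset.card_singleton]
  have hpair_empty : ∀ {f : Finset (Fin n)} {c d : ℕ},
      f ∩ (Finset.Icc 1 (3 * k - 2)).image x = {x c, x d} →
      1 ≤ c → c ≤ 3 * k - 2 → 1 ≤ d → d ≤ 3 * k - 2 → ∀ m, 1 ≤ m → m ≤ k - 1 →
      (c < 3 * m - 2 ∨ 3 * m + 1 < c) → (d < 3 * m - 2 ∨ 3 * m + 1 < d) →
      f ∩ E m = ∅ := by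
    intro f c d hf hc hc' hd hd' m h₁ h₂ h₃ h₄
    rw [hpair hf hc hc' hd hd' m h₁ h₂, Finset.pair_inter_Icc_eq_empty h₃ h₄,
      Finset.image_empty]
  have hfa' := hfa.trans (Finset.pair_comm _ _)
  have hfb' := hfb.trans (Finset.pair_comm _ _)
  have ha₁ : ∀ m, 1 ≤ m → m ≤ k - 1 → _ → _ → (f₁ ∩ E m).card = 1 :=
    hpair_one hfa (by omega) (by omega) (by omega) (by omega)
  have ha₁' : ∀ m, 1 ≤ m → m ≤ k - 1 → _ → _ → (f₁ ∩ E m).card = 1 :=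
    hpair_one hfa' (by omega) (by omega) (by omega) (by omega)
  have ha₀ : ∀ m, 1 ≤ m → m ≤ k - 1 → _ → _ → f₁ ∩ E m = ∅ :=
    hpair_empty hfa (by omega) (by omega) (by omega) (by omega)
  have hb₁ : ∀ m, 1 ≤ m → m ≤ k - 1 → _ → _ → (f₂ ∩ E m).card = 1 :=
    hpair_one hfb (by omega) (by omega) (by omega) (by omega)
  have hb₁' : ∀ m, 1 ≤ m → m ≤ k - 1 → _ → _ → (f₂ ∩ E m).card = 1 :=
    hpair_one hfb' (by omega) (by omega) (by omega) (by omega)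
  have hb₀ : ∀ m, 1 ≤ m → m ≤ k - 1 → _ → _ → f₂ ∩ E m = ∅ :=
    hpair_empty hfb (by omega) (by omega) (by omega) (by omega)
  clear_value E
  apply hfree
  obtain ⟨j, rfl | rfl⟩ : ∃ j, i = 3 * j ∨ i = 3 * j + 1 := ⟨i / 3, by omega⟩
  · -- `e_{j-1}, …, e_1, f₁, e_{j+1}, …, e_{k-1}, f₂`
    refine ⟨fun t => if (t : ℕ) < j - 1 then E (j - 1 - t) else if (t : ℕ) = j - 1 then f₁
      else if (t : ℕ) ≤ k - 2 then E (t + 1) else f₂, ?_, ?_, ?_⟩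
    · rintro ⟨t, ht⟩
      dsimp only
      split_ifs
      exacts [hE _ (by omega) (by omega), hf₁, hE _ (by omega) (by omega), hf₂]
    · rintro ⟨s, hs⟩ ⟨t, ht⟩ hst
      dsimp only at hst ⊢
      split_ifs <;> first
        | omega
        | exact hadj _ _ (by omega) (by omega) (by omega)
        | exact hadj' _ _ (by omega) (by omega) (by omega)
        | exact ha₁' _ (by omega) (by omega) (by omega) (by omega)
        | (rw [Finset.inter_comm]; first
            | exact ha₁ _ (by omega) (by omega) (by omega) (by omega)
            | exact hb₁ _ (by omega) (by omega) (by omega) (by omega))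
    · rintro ⟨s, hs⟩ ⟨t, ht⟩ hst
      dsimp only at hst ⊢
      split_ifs <;> first
        | omega
        | assumption
        | exact hfar _ _ (by omega) (by omega) (by omega) (by omega) (by omega)
        | exact ha₀ _ (by omega) (by omega) (by omega) (by omega)
        | (rw [Finset.inter_comm]; first
            | exact ha₀ _ (by omega) (by omega) (by omega) (by omega)
            | exact hb₀ _ (by omega) (by omega) (by omega) (by omega))
  · -- `f₁, e_1, …, e_j, f₂, e_{k-1}, …, e_{j+2}`
    refine ⟨fun t => if (t : ℕ) = 0 then f₁ else if (t : ℕ) ≤ j then E t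
      else if (t : ℕ) = j + 1 then f₂ else E (k + 1 + j - t), ?_, ?_, ?_⟩
    · rintro ⟨t, ht⟩
      dsimp only
      split_ifs
      exacts [hf₁, hE _ (by omega) (by omega), hf₂, hE _ (by omega) (by omega)]
    · rintro ⟨s, hs⟩ ⟨t, ht⟩ hst
      dsimp only at hst ⊢
      split_ifs <;> first
        | omega
        | exact hadj _ _ (by omega) (by omega) (by omega)
        | exact hadj' _ _ (by omega) (by omega) (by omega)
        | exact ha₁ _ (by omega) (by omega) (by omega) (by omega)
        | exact hb₁ _ (by omega) (by omega) (by omega) (by omega)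
        | (rw [Finset.inter_comm]
           exact hb₁' _ (by omega) (by omega) (by omega) (by omega))
    · rintro ⟨s, hs⟩ ⟨t, ht⟩ hst
      dsimp only at hst ⊢
      split_ifs <;> first
        | omega
        | assumption
        | exact hfar _ _ (by omega) (by omega) (by omega) (by omega) (by omega)
        | exact ha₀ _ (by omega) (by omega) (by omega) (by omega)
        | exact hb₀ _ (by omega) (by omega) (by omega) (by omega)
        | (rw [Finset.inter_comm]
           exact hb₀ _ (by omega) (by omega) (by omega) (by omega))
end

section
/- Let k ≥ 5 and let H be a P_k-free linear quadruple system containing a linear 4-path P with quadruples e_i = {x_{3i−2}, x_{3i−1}, x_{3i}, x_{3i+1}} for i = 1, …, k−1. For an origin vertex x_a let A_1(x_a) be the set of quadruples of H containing x_a, one internal vertex and two external vertices, and for a terminus vertex x_b let B_1(x_b) be the set of quadruples of H containing x_b, one internal vertex and two external vertices. Then there exist an origin vertex x_a and a terminus vertex x_b such that |A_1(x_a)| + |B_1(x_b)| ≤ 4(k−3). -/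
/-- The quadruple `e_i` of the linear path on the vertices `x 1, x 2, …`. -/
def pathEdge {n : ℕ} (x : ℕ → Fin n) (i : ℕ) : Finset (Fin n) :=
  (Finset.Icc (3 * i - 2) (3 * i + 1)).image x

theorem pathEdge_eq {n : ℕ} (x : ℕ → Fin n) {i : ℕ} (hi : 1 ≤ i) :
    pathEdge x i = {x (3 * i - 2), x (3 * i - 1), x (3 * i), x (3 * i + 1)} := by
  have h : Finset.Icc (3 * i - 2) (3 * i + 1) = {3 * i - 2, 3 * i - 1, 3 * i, 3 * i + 1} := by
    ext p
    simp only [Finset.mem_Icc, Finset.mem_insert, Finset.mem_singleton]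
    omega
  simp [pathEdge, h, Finset.image_insert]

theorem pathEdge_subset {n k : ℕ} (x : ℕ → Fin n) {i : ℕ} (hi : 1 ≤ i) (hik : i ≤ k - 1) :
    pathEdge x i ⊆ (Finset.Icc 1 (3 * k - 2)).image x :=
  Finset.image_subset_image (Finset.Icc_subset_Icc (by omega) (by omega))

theorem mem_pathEdge_iff {n k : ℕ} {x : ℕ → Fin n} (hinj : Set.InjOn x (Set.Icc 1 (3 * k - 2)))
    {i p : ℕ} (hi : 1 ≤ i) (hik : i ≤ k - 1) (hp : 1 ≤ p) (hpk : p ≤ 3 * k - 2) :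
    x p ∈ pathEdge x i ↔ 3 * i - 2 ≤ p ∧ p ≤ 3 * i + 1 := by
  simp only [pathEdge, Finset.mem_image, Finset.mem_Icc]
  constructor
  · rintro ⟨q, hq, hqp⟩
    obtain rfl := hinj (Set.mem_Icc.2 (by omega)) (Set.mem_Icc.2 (by omega)) hqp
    exact hq
  · exact fun h => ⟨p, h, rfl⟩

theorem pathEdge_inter_succ {n k : ℕ} {x : ℕ → Fin n}
    (hinj : Set.InjOn x (Set.Icc 1 (3 * k - 2))) {i : ℕ} (hi : 1 ≤ i) (hik : i + 1 ≤ k - 1) :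
    (pathEdge x i ∩ pathEdge x (i + 1)).card = 1 := by
  rw [Finset.card_eq_one]
  refine ⟨x (3 * i + 1), ?_⟩
  ext v
  simp only [Finset.mem_inter, Finset.mem_singleton]
  constructor
  · rintro ⟨h₁, h₂⟩
    obtain ⟨p, hp, rfl⟩ := Finset.mem_image.1 h₁
    rw [Finset.mem_Icc] at hp
    rw [mem_pathEdge_iff hinj (by omega) hik (by omega) (by omega)] at h₂
    congr 1
    omega
  · rintro rfl
    rw [mem_pathEdge_iff hinj, mem_pathEdge_iff hinj] <;> omega

theorem pathEdge_inter_eq_empty {n k : ℕ} {x : ℕ → Fin n}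
    (hinj : Set.InjOn x (Set.Icc 1 (3 * k - 2))) {i j : ℕ} (hi : 1 ≤ i) (hij : i + 2 ≤ j)
    (hjk : j ≤ k - 1) : pathEdge x i ∩ pathEdge x j = ∅ := by
  rw [← Finset.disjoint_iff_inter_eq_empty, Finset.disjoint_left]
  intro v h₁ h₂
  obtain ⟨p, hp, rfl⟩ := Finset.mem_image.1 h₁
  rw [Finset.mem_Icc] at hp
  rw [mem_pathEdge_iff hinj] at h₂ <;> omega

/-- An edge meeting the path in `{x a, x j}` misses each quadruple of the path containing
neither of these vertices. -/
theorem inter_pathEdge_eq_empty {n k : ℕ} {x : ℕ → Fin n}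
    (hinj : Set.InjOn x (Set.Icc 1 (3 * k - 2))) {f : Finset (Fin n)} {a j i : ℕ}
    (hf : f ∩ (Finset.Icc 1 (3 * k - 2)).image x = {x a, x j})
    (ha : 1 ≤ a) (hak : a ≤ 3 * k - 2) (hj : 1 ≤ j) (hjk : j ≤ 3 * k - 2)
    (hi : 1 ≤ i) (hik : i ≤ k - 1)
    (hai : ¬ (3 * i - 2 ≤ a ∧ a ≤ 3 * i + 1)) (hji : ¬ (3 * i - 2 ≤ j ∧ j ≤ 3 * i + 1)) :
    f ∩ pathEdge x i = ∅ := by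
  rw [← Finset.disjoint_iff_inter_eq_empty, Finset.disjoint_left]
  intro v h₁ h₂
  have hv : v ∈ ({x a, x j} : Finset (Fin n)) :=
    hf ▸ Finset.mem_inter.2 ⟨h₁, pathEdge_subset x hi hik h₂⟩
  rw [Finset.mem_insert, Finset.mem_singleton] at hv
  rcases hv with rfl | rfl
  · exact hai ((mem_pathEdge_iff hinj hi hik ha hak).1 h₂)
  · exact hji ((mem_pathEdge_iff hinj hi hik hj hjk).1 h₂)

/-- An edge meeting the path in `{x a, x j}` meets in one vertex each quadruple of the path
containing `x a` but not `x j`. -/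
theorem card_inter_pathEdge_eq_one {n k : ℕ} {x : ℕ → Fin n}
    (hinj : Set.InjOn x (Set.Icc 1 (3 * k - 2))) {f : Finset (Fin n)} {a j i : ℕ}
    (hf : f ∩ (Finset.Icc 1 (3 * k - 2)).image x = {x a, x j})
    (ha : 1 ≤ a) (hak : a ≤ 3 * k - 2) (hj : 1 ≤ j) (hjk : j ≤ 3 * k - 2)
    (hi : 1 ≤ i) (hik : i ≤ k - 1)
    (hai : 3 * i - 2 ≤ a ∧ a ≤ 3 * i + 1) (hji : ¬ (3 * i - 2 ≤ j ∧ j ≤ 3 * i + 1)) :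
    (f ∩ pathEdge x i).card = 1 := by
  rw [Finset.card_eq_one]
  refine ⟨x a, ?_⟩
  ext v
  rw [Finset.mem_inter, Finset.mem_singleton]
  constructor
  · rintro ⟨h₁, h₂⟩
    have hv : v ∈ ({x a, x j} : Finset (Fin n)) :=
      hf ▸ Finset.mem_inter.2 ⟨h₁, pathEdge_subset x hi hik h₂⟩
    rw [Finset.mem_insert, Finset.mem_singleton] at hv
    rcases hv with rfl | rfl
    · rfl
    · exact absurd ((mem_pathEdge_iff hinj hi hik hj hjk).1 h₂) hji
  · rintro rfl
    have h : x a ∈ f ∩ (Finset.Icc 1 (3 * k - 2)).image x := by simp [hf]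
    exact ⟨(Finset.mem_inter.1 h).1, (mem_pathEdge_iff hinj hi hik ha hak).2 hai⟩

/-- Two edges through a common degree-one vertex `x j` of an inner quadruple `e_i`, one
leading to an origin vertex and one to a terminus vertex, yield a path longer by one. -/
theorem containsPath_of_origin_of_terminus {n k : ℕ} (H : LinearQuadSystem n)
    (x : ℕ → Fin n) (hinj : Set.InjOn x (Set.Icc 1 (3 * k - 2)))
    (hP : ∀ i, 1 ≤ i → i ≤ k - 1 → pathEdge x i ∈ H.edges)
    {i j a b : ℕ} (hi : 2 ≤ i) (hik : i ≤ k - 2) (hj : j = 3 * i - 1 ∨ j = 3 * i)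
    (ha : 1 ≤ a) (ha' : a ≤ 3) (hb : 3 * k - 4 ≤ b) (hb' : b ≤ 3 * k - 2)
    {f g : Finset (Fin n)} (hfH : f ∈ H.edges) (hgH : g ∈ H.edges)
    (hf : f ∩ (Finset.Icc 1 (3 * k - 2)).image x = {x a, x j})
    (hg : g ∩ (Finset.Icc 1 (3 * k - 2)).image x = {x b, x j}) :
    ContainsPath k H := by
  have hfg : (f ∩ g).card = 1 := by
    have hne : f ≠ g := by
      rintro rfl
      have h : x a ∈ ({x b, x j} : Finset (Fin n)) := by simp [← hg, hf]
      rw [Finset.mem_insert, Finset.mem_singleton] at h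
      rcases h with h | h
      · have := hinj (Set.mem_Icc.2 (by omega)) (Set.mem_Icc.2 (by omega)) h
        omega
      · have := hinj (Set.mem_Icc.2 (by omega)) (Set.mem_Icc.2 (by omega)) h
        omega
    have hjf : x j ∈ f ∩ (Finset.Icc 1 (3 * k - 2)).image x := by simp [hf]
    have hjg : x j ∈ g ∩ (Finset.Icc 1 (3 * k - 2)).image x := by simp [hg]
    have hpos : 0 < (f ∩ g).card := Finset.card_pos.2
      ⟨x j, Finset.mem_inter.2 ⟨(Finset.mem_inter.1 hjf).1, (Finset.mem_inter.1 hjg).1⟩⟩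
    have := H.linear f hfH g hgH hne
    omega
  have hf₀ : ∀ l, 2 ≤ l → l ≤ k - 1 → l ≠ i → f ∩ pathEdge x l = ∅ := fun l h₁ h₂ h₃ =>
    inter_pathEdge_eq_empty hinj hf (by omega) (by omega) (by omega) (by omega) (by omega) h₂
      (by omega) (by omega)
  have hg₀ : ∀ l, 1 ≤ l → l ≤ k - 2 → l ≠ i → g ∩ pathEdge x l = ∅ := fun l h₁ h₂ h₃ =>
    inter_pathEdge_eq_empty hinj hg (by omega) (by omega) (by omega) (by omega) h₁ (by omega)
      (by omega) (by omega)
  have hf₁ : (f ∩ pathEdge x 1).card = 1 :=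
    card_inter_pathEdge_eq_one hinj hf (by omega) (by omega) (by omega) (by omega) (by omega)
      (by omega) (by omega) (by omega)
  have hg₁ : (g ∩ pathEdge x (k - 1)).card = 1 :=
    card_inter_pathEdge_eq_one hinj hg (by omega) (by omega) (by omega) (by omega) (by omega)
      (by omega) (by omega) (by omega)
  refine ⟨fun t => if (t : ℕ) + 1 < i then pathEdge x (i - 1 - t) else
    if (t : ℕ) + 1 = i then f else if (t : ℕ) = i then g else pathEdge x (k + i - t), ?_, ?_, ?_⟩
  · rintro ⟨t, ht⟩
    dsimp only
    split_ifs
    · exact hP _ (by omega) (by omega)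
    · exact hfH
    · exact hgH
    · exact hP _ (by omega) (by omega)
  · rintro ⟨s, hs⟩ ⟨t, ht⟩ hst
    dsimp only at hst ⊢
    split_ifs <;> try omega
    · rw [Finset.inter_comm, show i - 1 - s = (i - 1 - t) + 1 by omega]
      exact pathEdge_inter_succ hinj (by omega) (by omega)
    · rw [Finset.inter_comm, show i - 1 - s = 1 by omega]
      exact hf₁
    · rw [show k + i - t = k - 1 by omega]
      exact hg₁
    · rw [Finset.inter_comm, show k + i - s = (k + i - t) + 1 by omega]
      exact pathEdge_inter_succ hinj (by omega) (by omega)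
  · rintro ⟨s, hs⟩ ⟨t, ht⟩ hst
    dsimp only at hst ⊢
    split_ifs <;> try omega
    · rw [Finset.inter_comm]
      exact pathEdge_inter_eq_empty hinj (by omega) (by omega) (by omega)
    · rw [Finset.inter_comm]
      exact hf₀ _ (by omega) (by omega) (by omega)
    · rw [Finset.inter_comm]
      exact hg₀ _ (by omega) (by omega) (by omega)
    · exact pathEdge_inter_eq_empty hinj (by omega) (by omega) (by omega)
    · exact hf₀ _ (by omega) (by omega) (by omega)
    · exact hg₀ _ (by omega) (by omega) (by omega)
    · rw [Finset.inter_comm]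
      exact pathEdge_inter_eq_empty hinj (by omega) (by omega) (by omega)

theorem LinearQuadSystem.eq_of_mem_of_mem_s18 {n : ℕ} (H : LinearQuadSystem n)
    {f g : Finset (Fin n)} (hf : f ∈ H.edges) (hg : g ∈ H.edges) {u v : Fin n} (huv : u ≠ v)
    (huf : u ∈ f) (hvf : v ∈ f) (hug : u ∈ g) (hvg : v ∈ g) : f = g := by
  by_contra h
  have h₁ := H.linear f hf g hg h
  have h₂ : ({u, v} : Finset (Fin n)) ⊆ f ∩ g := by
    simp [Finset.insert_subset_iff, huf, hvf, hug, hvg]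
  have h₃ := Finset.card_le_card h₂
  rw [Finset.card_pair huv] at h₃
  omega

/-- No edge meets the path exactly in two vertices of a common quadruple of the path. -/
theorem inter_ne_pair_of_mem_pathEdge {n k : ℕ} (H : LinearQuadSystem n)
    {x : ℕ → Fin n} {i : ℕ} (hi : 1 ≤ i) (hik : i ≤ k - 1) (hE : pathEdge x i ∈ H.edges)
    {f : Finset (Fin n)} (hfH : f ∈ H.edges) {u v : Fin n} (huv : u ≠ v)
    (hu : u ∈ pathEdge x i) (hv : v ∈ pathEdge x i) :
    f ∩ (Finset.Icc 1 (3 * k - 2)).image x ≠ {u, v} := by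
  intro hf
  have huf : u ∈ f ∩ (Finset.Icc 1 (3 * k - 2)).image x := by simp [hf]
  have hvf : v ∈ f ∩ (Finset.Icc 1 (3 * k - 2)).image x := by simp [hf]
  obtain rfl := H.eq_of_mem_of_mem_s18 hfH hE huv (Finset.mem_inter.1 huf).1
    (Finset.mem_inter.1 hvf).1 hu hv
  rw [Finset.inter_eq_left.2 (pathEdge_subset x hi hik)] at hf
  have h := H.card_four _ hE
  rw [hf, Finset.card_pair huv] at h
  omega

open scoped Classical in
/-- Edges meeting `X` in a pair `{u, x j}` are counted by the indices `j`. -/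
theorem card_filter_inter_eq_pair_le {n : ℕ} (H : LinearQuadSystem n) (x : ℕ → Fin n)
    (X : Finset (Fin n)) (u : Fin n) (l m : ℕ) (hu : ∀ j, l ≤ j → j ≤ m → u ≠ x j) :
    (H.edges.filter (fun f => ∃ j, l ≤ j ∧ j ≤ m ∧ f ∩ X = {u, x j})).card ≤
      ∑ j ∈ Finset.Icc l m, if ∃ f ∈ H.edges, f ∩ X = {u, x j} then 1 else 0 := by
  have hsub : H.edges.filter (fun f => ∃ j, l ≤ j ∧ j ≤ m ∧ f ∩ X = {u, x j}) ⊆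
      (Finset.Icc l m).biUnion fun j => H.edges.filter fun f => f ∩ X = {u, x j} := by
    intro f hf
    obtain ⟨hfH, j, h₁, h₂, h₃⟩ := Finset.mem_filter.1 hf
    exact Finset.mem_biUnion.2 ⟨j, Finset.mem_Icc.2 ⟨h₁, h₂⟩, Finset.mem_filter.2 ⟨hfH, h₃⟩⟩
  refine (Finset.card_le_card hsub).trans (Finset.card_biUnion_le.trans
    (Finset.sum_le_sum fun j hj => ?_))
  rw [Finset.mem_Icc] at hj
  split_ifs with h
  · rw [Finset.card_le_one]
    intro f hf g hg
    rw [Finset.mem_filter] at hf hg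
    have mem : ∀ {e : Finset (Fin n)} {v : Fin n}, e ∩ X = {u, x j} →
        v ∈ ({u, x j} : Finset (Fin n)) → v ∈ e := fun he hv =>
      (Finset.mem_inter.1 (he.symm ▸ hv)).1
    exact H.eq_of_mem_of_mem_s18 hf.1 hg.1 (hu j hj.1 hj.2) (mem hf.2 (by simp)) (mem hf.2 (by simp))
      (mem hg.2 (by simp)) (mem hg.2 (by simp))
  · rw [Nat.le_zero, Finset.card_eq_zero, Finset.filter_eq_empty_iff]
    exact fun f hf hfX => h ⟨f, hf, hfX⟩

theorem sum_Icc_three_mul (c d : ℕ → ℕ) (m : ℕ) :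
    ∑ j ∈ Finset.Icc 4 (3 * m + 4), c j + ∑ j ∈ Finset.Icc 4 (3 * m + 4), d j =
      c 4 + d (3 * m + 4) + ∑ i ∈ Finset.range m,
        (c (3 * i + 5) + c (3 * i + 6) + c (3 * i + 7) +
          (d (3 * i + 4) + d (3 * i + 5) + d (3 * i + 6))) := by
  induction m with
  | zero => simp
  | succ m ih =>
    have h : ∀ e : ℕ → ℕ, ∑ j ∈ Finset.Icc 4 (3 * (m + 1) + 4), e j =
        ∑ j ∈ Finset.Icc 4 (3 * m + 4), e j + e (3 * m + 5) + e (3 * m + 6) + e (3 * m + 7) := by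
      intro e
      rw [show 3 * (m + 1) + 4 = 3 * m + 4 + 1 + 1 + 1 by ring,
        Finset.sum_Icc_succ_top (by omega), Finset.sum_Icc_succ_top (by omega),
        Finset.sum_Icc_succ_top (by omega)]
    rw [h, h, Finset.sum_range_succ, show 3 * (m + 1) + 4 = 3 * m + 7 by ring]
    omega

open scoped Classical in
/-- let `k ≥ 5` and let `H` be a `P_k`-free linear quadruple system
containing a path `P = P_{k-1}` with quadruples
`e_i = {x_{3i-2}, x_{3i-1}, x_{3i}, x_{3i+1}}` (`1 ≤ i ≤ k-1`) on distinct vertices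
`x_1, …, x_{3k-2}`.  `A₁(x_a)` (resp. `B₁(x_b)`) is the set of quadruples of `H`
consisting of the origin vertex `x_a` (resp. terminus vertex `x_b`), one internal
vertex and two external vertices.  Then there exist an origin vertex `x_a` and a
terminus vertex `x_b` with `|A₁(x_a)| + |B₁(x_b)| ≤ 4(k-3)`. -/
theorem exists_small_A1_B1 (n k : ℕ) (hk : 5 ≤ k) (H : LinearQuadSystem n)
    (hfree : ¬ ContainsPath k H)
    (x : ℕ → Fin n) (hinj : Set.InjOn x (Set.Icc 1 (3 * k - 2)))
    (hP : ∀ i, 1 ≤ i → i ≤ k - 1 →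
      ({x (3 * i - 2), x (3 * i - 1), x (3 * i), x (3 * i + 1)} : Finset (Fin n))
        ∈ H.edges) :
    ∃ a ∈ ({1, 2, 3} : Finset ℕ), ∃ b ∈ ({3 * k - 4, 3 * k - 3, 3 * k - 2} : Finset ℕ),
      (H.edges.filter (fun f => ∃ j, 4 ≤ j ∧ j ≤ 3 * k - 5 ∧
          f ∩ (Finset.Icc 1 (3 * k - 2)).image x = {x a, x j})).card +
      (H.edges.filter (fun f => ∃ j, 4 ≤ j ∧ j ≤ 3 * k - 5 ∧
          f ∩ (Finset.Icc 1 (3 * k - 2)).image x = {x b, x j})).card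
      ≤ 4 * (k - 3) := by
  have hE : ∀ i, 1 ≤ i → i ≤ k - 1 → pathEdge x i ∈ H.edges := fun i h₁ h₂ =>
    pathEdge_eq x h₁ ▸ hP i h₁ h₂
  have hne : ∀ p q, 1 ≤ p → p ≤ 3 * k - 2 → 1 ≤ q → q ≤ 3 * k - 2 → p ≠ q → x p ≠ x q :=
    fun p q h₁ h₂ h₃ h₄ h h' =>
      h (hinj (Set.mem_Icc.2 ⟨h₁, h₂⟩) (Set.mem_Icc.2 ⟨h₃, h₄⟩) h')
  set X := (Finset.Icc 1 (3 * k - 2)).image x with hX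
  let c : ℕ → ℕ → ℕ := fun a j => if ∃ f ∈ H.edges, f ∩ X = {x a, x j} then 1 else 0
  have hc : ∀ a j, c a j ≤ 1 := fun a j => by dsimp only [c]; split_ifs <;> omega
  have hcount : ∀ a, (1 ≤ a ∧ a ≤ 3 ∨ 3 * k - 4 ≤ a ∧ a ≤ 3 * k - 2) →
      (H.edges.filter (fun f => ∃ j, 4 ≤ j ∧ j ≤ 3 * k - 5 ∧ f ∩ X = {x a, x j})).card ≤
        ∑ j ∈ Finset.Icc 4 (3 * k - 5), c a j := fun a ha =>
    card_filter_inter_eq_pair_le H x X (x a) 4 (3 * k - 5) fun j h₁ h₂ =>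
      hne a j (by omega) (by omega) (by omega) (by omega) (by omega)
  have horigin : ∀ a, 1 ≤ a → a ≤ 3 → c a 4 = 0 := by
    intro a h₁ h₂
    refine if_neg ?_
    rintro ⟨f, hfH, hf⟩
    refine inter_ne_pair_of_mem_pathEdge (i := 1) H le_rfl (by omega) (hE 1 le_rfl (by omega)) hfH
      (hne a 4 h₁ (by omega) (by omega) (by omega) (by omega)) ?_ ?_ hf <;>
    rw [mem_pathEdge_iff hinj] <;> omega
  have hterminus : ∀ b, 3 * k - 4 ≤ b → b ≤ 3 * k - 2 → c b (3 * k - 5) = 0 := by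
    intro b h₁ h₂
    refine if_neg ?_
    rintro ⟨f, hfH, hf⟩
    refine inter_ne_pair_of_mem_pathEdge (i := k - 1) H (by omega) le_rfl
      (hE _ (by omega) le_rfl) hfH
      (hne b (3 * k - 5) (by omega) (by omega) (by omega) (by omega) (by omega)) ?_ ?_ hf <;>
    rw [mem_pathEdge_iff hinj] <;> omega
  have hinner : ∀ a b i j, 1 ≤ a → a ≤ 3 → 3 * k - 4 ≤ b → b ≤ 3 * k - 2 → i < k - 3 →
      (j = 3 * i + 5 ∨ j = 3 * i + 6) → c a j + c b j ≤ 1 := by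
    intro a b i j ha ha' hb hb' hi hj
    by_contra h
    dsimp only [c] at h
    split_ifs at h with h₁ h₂
    · obtain ⟨f, hfH, hf⟩ := h₁
      obtain ⟨g, hgH, hg⟩ := h₂
      exact hfree (containsPath_of_origin_of_terminus (i := i + 2) H x hinj hE (by omega)
        (by omega) (by omega) ha ha' hb hb' hfH hgH hf hg)
    all_goals omega
  have hpair : ∀ a b, 1 ≤ a → a ≤ 3 → 3 * k - 4 ≤ b → b ≤ 3 * k - 2 →
      ∑ j ∈ Finset.Icc 4 (3 * k - 5), c a j + ∑ j ∈ Finset.Icc 4 (3 * k - 5), c b j ≤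
        4 * (k - 3) := by
    intro a b ha ha' hb hb'
    have hk' : 3 * k - 5 = 3 * (k - 3) + 4 := by omega
    have hb₀ := hterminus b hb hb'
    rw [hk'] at hb₀ ⊢
    rw [sum_Icc_three_mul, horigin a ha ha', hb₀, zero_add, zero_add]
    calc _ ≤ ∑ i ∈ Finset.range (k - 3), 4 := Finset.sum_le_sum fun i hi => ?_
      _ = 4 * (k - 3) := by simp [mul_comm]
    have hi' := Finset.mem_range.1 hi
    have h₁ := hinner a b i (3 * i + 5) ha ha' hb hb' hi' (Or.inl rfl)
    have h₂ := hinner a b i (3 * i + 6) ha ha' hb hb' hi' (Or.inr rfl)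
    have h₃ := hc a (3 * i + 7)
    have h₄ := hc b (3 * i + 4)
    omega
  exact ⟨1, by simp, 3 * k - 4, by simp, (add_le_add (hcount 1 (by omega))
    (hcount (3 * k - 4) (by omega))).trans
      (hpair 1 (3 * k - 4) le_rfl (by omega) le_rfl (by omega))⟩
end

section
/- Let k ≥ 4 and let H be an M_k-free linear quadruple system containing a 4-matching M_{k−1} with quadruples X_1, …, X_{k−1}. Let E_1 be the set of quadruples of H that intersect the vertex set of M_{k−1} in exactly one vertex. Then for each i, if some vertex v of X_i is contained in at least 4 quadruples of E_1, then every vertex of X_i other than v is contained in no quadruple of E_1. -/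
/-- `H` contains the 4-matching `M_k`: `k` pairwise disjoint quadruples. -/
def ContainsMatching {n : ℕ} (k : ℕ) (H : LinearQuadSystem n) : Prop :=
  ∃ e : Fin k → Finset (Fin n),
    (∀ i, e i ∈ H.edges) ∧ ∀ i j, i ≠ j → Disjoint (e i) (e j)

/-- If some `X i` can be exchanged for two disjoint edges that avoid every other `X j`, then the
matching `X` can be enlarged by one edge. -/
theorem containsMatching_succ_of_exchange {n m : ℕ} {H : LinearQuadSystem n}
    {X : Fin m → Finset (Fin n)} (hX : ∀ i, X i ∈ H.edges)
    (hdisj : ∀ i j, i ≠ j → Disjoint (X i) (X j)) {i : Fin m} {f g : Finset (Fin n)}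
    (hf : f ∈ H.edges) (hg : g ∈ H.edges) (hfg : Disjoint f g)
    (hfX : ∀ j, j ≠ i → Disjoint f (X j)) (hgX : ∀ j, j ≠ i → Disjoint g (X j)) :
    ContainsMatching (m + 1) H := by
  have hfY : ∀ j, Disjoint f (Function.update X i g j) := by
    intro j
    by_cases hj : j = i
    · subst hj; simpa using hfg
    · simpa [hj] using hfX j hj
  refine ⟨Fin.cons f (Function.update X i g), fun a => ?_, fun a b hab => ?_⟩
  · induction a using Fin.cases with
    | zero => simpa using hf
    | succ j =>
      by_cases hj : j = i
      · subst hj; simpa using hg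
      · simpa [hj] using hX j
  · induction a using Fin.cases with
    | zero =>
      induction b using Fin.cases with
      | zero => exact absurd rfl hab
      | succ b => simpa using hfY b
    | succ a =>
      induction b using Fin.cases with
      | zero => simpa using (hfY a).symm
      | succ b =>
        have hne : a ≠ b := fun h => hab (congrArg Fin.succ h)
        by_cases ha : a = i
        · subst ha; simpa [hne.symm] using hgX b hne.symm
        · by_cases hb : b = i
          · subst hb; simpa [hne] using (hgX a hne).symm
          · simpa [ha, hb] using hdisj a b hne

/-- Among the edges through `v`, at most `f.card` meet a set `f` not containing `v`. -/
theorem LinearQuadSystem.exists_disjoint_of_card_lt {n : ℕ} (H : LinearQuadSystem n)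
    {S : Finset (Finset (Fin n))} {v : Fin n} (hS : ∀ g ∈ S, g ∈ H.edges ∧ v ∈ g)
    {f : Finset (Fin n)} (hv : v ∉ f) (hcard : f.card < S.card) :
    ∃ g ∈ S, Disjoint f g := by
  by_contra! hmeet
  have hw : ∀ g ∈ S, ∃ w ∈ f, w ∈ g := fun g hg => Finset.not_disjoint_iff.1 (hmeet g hg)
  have : Nonempty (Fin n) := ⟨v⟩
  choose! w hwf hwg using hw
  obtain ⟨g, hg, g', hg', hne, heq⟩ :=
    Finset.exists_ne_map_eq_of_card_lt_of_maps_to hcard hwf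
  have hle := H.linear g (hS g hg).1 g' (hS g' hg').1 hne
  have hvw : v = w g := Finset.card_le_one.1 hle v
    (Finset.mem_inter.2 ⟨(hS g hg).2, (hS g' hg').2⟩) (w g)
    (Finset.mem_inter.2 ⟨hwg g hg, heq ▸ hwg g' hg'⟩)
  exact hv (hvw ▸ hwf g hg)

/-- A set meeting the union of a disjoint family in a single vertex of `X i` avoids every
other `X j`. -/
theorem disjoint_of_card_inter_biUnion_eq_one {n m : ℕ} {X : Fin m → Finset (Fin n)}
    (hdisj : ∀ i j, i ≠ j → Disjoint (X i) (X j)) {i : Fin m} {v : Fin n} (hv : v ∈ X i)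
    {f : Finset (Fin n)} (hf : (f ∩ Finset.univ.biUnion X).card = 1) (hvf : v ∈ f)
    (j : Fin m) (hj : j ≠ i) : Disjoint f (X j) := by
  refine Finset.disjoint_left.2 fun x hxf hxj => ?_
  have hxv : x = v := Finset.card_le_one.1 hf.le x
    (Finset.mem_inter.2 ⟨hxf, Finset.mem_biUnion.2 ⟨j, Finset.mem_univ j, hxj⟩⟩) v
    (Finset.mem_inter.2 ⟨hvf, Finset.mem_biUnion.2 ⟨i, Finset.mem_univ i, hv⟩⟩)
  exact Finset.disjoint_left.1 (hdisj j i hj) hxj (hxv ▸ hv)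

/-- let `k ≥ 4`, let `H` be an `M_k`-free linear quadruple system
containing a 4-matching `X_1, …, X_{k-1}`, and let `E₁` be the set of quadruples of
`H` meeting the vertex set of the matching in exactly one vertex.  If some vertex `v`
of `X_i` lies in at least 4 quadruples of `E₁`, then every other vertex of `X_i` lies
in no quadruple of `E₁`. -/
theorem matching_degree_concentration (n k : ℕ) (hk : 4 ≤ k)
    (H : LinearQuadSystem n) (hfree : ¬ ContainsMatching k H)
    (X : Fin (k - 1) → Finset (Fin n)) (hX : ∀ i, X i ∈ H.edges)
    (hdisj : ∀ i j, i ≠ j → Disjoint (X i) (X j)) :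
    ∀ i, ∀ v ∈ X i,
      4 ≤ ((H.edges.filter
          (fun f => (f ∩ Finset.univ.biUnion X).card = 1)).filter
            (fun f => v ∈ f)).card →
      ∀ u ∈ X i, u ≠ v →
        ∀ f ∈ H.edges, (f ∩ Finset.univ.biUnion X).card = 1 → u ∉ f := by
  intro i v hv hdeg u hu huv f hf hf1 huf
  obtain ⟨m, rfl⟩ : ∃ m, k = m + 1 := ⟨k - 1, by omega⟩
  have hXi : ∀ {x}, x ∈ X i → x ∈ Finset.univ.biUnion X :=
    fun hx => Finset.mem_biUnion.2 ⟨i, Finset.mem_univ i, hx⟩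
  have hunique : ∀ {g : Finset (Fin n)}, (g ∩ Finset.univ.biUnion X).card = 1 →
      u ∈ g → v ∉ g := fun hg hug hvg =>
    huv (Finset.card_le_one.1 hg.le u (Finset.mem_inter.2 ⟨hug, hXi hu⟩) v
      (Finset.mem_inter.2 ⟨hvg, hXi hv⟩))
  set S := (H.edges.filter (fun f => (f ∩ Finset.univ.biUnion X).card = 1)).filter
    (fun f => v ∈ f) with hS
  have hmem : ∀ g ∈ S, (g ∈ H.edges ∧ (g ∩ Finset.univ.biUnion X).card = 1) ∧ v ∈ g := by
    intro g hg
    simpa only [hS, Finset.mem_filter] using hg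
  have hcard : (f.erase u).card < S.card := by
    rw [Finset.card_erase_of_mem huf, H.card_four f hf]
    omega
  obtain ⟨g, hgS, hfg⟩ := H.exists_disjoint_of_card_lt
    (fun g hg => ⟨(hmem g hg).1.1, (hmem g hg).2⟩)
    (fun h => hunique hf1 huf (Finset.mem_of_mem_erase h)) hcard
  obtain ⟨⟨hg, hg1⟩, hvg⟩ := hmem g hgS
  have hug : u ∉ g := fun hug => hunique hg1 hug hvg
  have hfg' : Disjoint f g := by
    rw [← Finset.insert_erase huf]
    exact Finset.disjoint_insert_left.2 ⟨hug, hfg⟩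
  exact hfree (containsMatching_succ_of_exchange (i := i) hX hdisj hf hg hfg'
    (disjoint_of_card_inter_biUnion_eq_one hdisj hu hf1 huf)
    (disjoint_of_card_inter_biUnion_eq_one hdisj hv hg1 hvg))
end
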